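/- arXiv:1812.01847 — 4 statements merged into one kernel-verified Lean document; each statement's English description precedes it below -/
import Mathlib

section
/- Let n ≥ 1, s ∈ (0,1) and R > 0. There exists a unique r ∈ (0,R) such that, for the annulus A = B_R \ B_r, the principal values H_s(x_r, A) and H_s(x_R, A) exist for points x_r ∈ ∂B_r, x_R ∈ ∂B_R, and R·H_s(x_r, A) + r·H_s(x_R, A) = 0. (This is exactly the condition making A a homothetically shrinking solution of the fractional mean curvature flow, i.e. x·ν = c·H_s(x,A) on ∂A for some constant c > 0.) -/
open MeasureTheory Filter Metric Set

/-- `HasFracMeanCurvAt n s E x H` means that the fractional mean curvature of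
`E ⊆ ℝⁿ` at the point `x`, i.e. the principal value
`lim_{ε→0⁺} ∫_{|y-x|>ε} (χ_{Eᶜ}(y) - χ_E(y)) |x-y|^{-(n+s)} dy`, exists and equals `H`. -/
def HasFracMeanCurvAt (n : ℕ) (s : ℝ) (E : Set (EuclideanSpace ℝ (Fin n)))
    (x : EuclideanSpace ℝ (Fin n)) (H : ℝ) : Prop :=
  Tendsto (fun ε : ℝ =>
      ∫ y in {y : EuclideanSpace ℝ (Fin n) | ε < dist y x},
        (Set.indicator Eᶜ (fun _ => (1 : ℝ)) y - Set.indicator E (fun _ => (1 : ℝ)) y)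
          * ‖x - y‖ ^ (-((n : ℝ) + s)))
    (nhdsWithin 0 (Set.Ioi 0)) (nhds H)

theorem integrable_indicator_Icc_abs_rpow {r : ℝ} (hr : -1 < r) :
    Integrable ((Icc (-1 : ℝ) 1).indicator fun u => |u| ^ r) := by
  have h0 : IntegrableOn (fun u : ℝ => |u| ^ r) (Icc 0 1) := by
    have h := intervalIntegral.intervalIntegrable_rpow' (a := 0) (b := 1) hr
    rw [intervalIntegrable_iff_integrableOn_Icc_of_le zero_le_one] at h
    exact h.congr_fun (fun u hu => by simp [abs_of_nonneg hu.1]) measurableSet_Icc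
  have h1 : IntegrableOn (fun u : ℝ => |u| ^ r) (Icc (-1) 0) := by
    have h := h0.comp_neg
    simpa using h
  rw [integrable_indicator_iff measurableSet_Icc, ← Icc_union_Icc_eq_Icc (b := 0) (by norm_num)
    (by norm_num)]
  exact h1.union h0

theorem measurable_norm_sub_rpow {n : ℕ} (x : EuclideanSpace ℝ (Fin n)) (p : ℝ) :
    Measurable fun y => ‖x - y‖ ^ p :=
  (measurable_const.sub measurable_id).norm.pow_const p

theorem integrableOn_norm_rpow_of_lt_norm {n : ℕ} {s ε : ℝ} (hs : 0 < s) (hε : 0 < ε) :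
    IntegrableOn (fun w : EuclideanSpace ℝ (Fin n) => ‖w‖ ^ (-((n : ℝ) + s))) {w | ε < ‖w‖} := by
  have h := (integrable_one_add_norm (E := EuclideanSpace ℝ (Fin n)) (μ := volume)
    (r := (n : ℝ) + s) (by simpa using hs)).const_mul ((ε / (1 + ε)) ^ (-((n : ℝ) + s)))
  refine (h.integrableOn (s := {w | ε < ‖w‖})).mono'
    (measurable_norm.pow_const _).aestronglyMeasurable ?_
  refine (ae_restrict_iff' (measurableSet_lt measurable_const measurable_norm)).2 (ae_of_all _ ?_)
  intro w (hw : ε < ‖w‖)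
  rw [Real.norm_of_nonneg (by positivity), ← Real.mul_rpow (by positivity) (by positivity)]
  refine Real.rpow_le_rpow_of_nonpos (by positivity) ?_ (by linarith [n.cast_nonneg (α := ℝ)])
  rw [div_mul_eq_mul_div, div_le_iff₀ (by positivity)]
  nlinarith

theorem integrableOn_norm_rpow_of_coord_le_sq {n : ℕ} {s : ℝ} (hs : s ∈ Ioo (0 : ℝ) 1)
    (i : Fin n) :
    IntegrableOn (fun w : EuclideanSpace ℝ (Fin n) => ‖w‖ ^ (-((n : ℝ) + s)))
      {w | 2 * |w i| ≤ ‖w‖ ^ 2} := by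
  have hn : (1 : ℝ) ≤ n := by exact_mod_cast i.pos
  obtain ⟨hs0, hs1⟩ := hs
  set δ : ℝ := (1 - s) / 2 with hδ
  set e : Fin n → ℝ := fun j => if j = i then -((1 + s + δ) / 2) else -(1 - δ / n) with he
  have hδn : 0 < δ / n := by
    have : 0 < δ := by linarith
    positivity
  have hδn' : δ / n ≤ δ := div_le_self (by linarith) hn
  have hint : Integrable (fun w : EuclideanSpace ℝ (Fin n) =>
      ∏ j, (Icc (-1 : ℝ) 1).indicator (fun u => |u| ^ e j) (w j)) := by
    have h := Integrable.fintype_prod (μ := fun _ : Fin n => (volume : Measure ℝ))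
      (f := fun j => (Icc (-1 : ℝ) 1).indicator (fun u => |u| ^ e j)) (fun j =>
        integrable_indicator_Icc_abs_rpow (by simp only [he]; split_ifs <;> linarith))
    exact (PiLp.volume_preserving_ofLp (Fin n)).integrable_comp_of_integrable h
  have hne : ∀ᵐ w : EuclideanSpace ℝ (Fin n), ∀ j, w j ≠ 0 := by
    rw [ae_all_iff]
    intro j
    exact (PiLp.volume_preserving_ofLp (Fin n)).quasiMeasurePreserving.ae
      (Measure.ae_eval_ne (fun _ : Fin n => (volume : Measure ℝ)) j 0)
  have hW : MeasurableSet {w : EuclideanSpace ℝ (Fin n) | 2 * |w i| ≤ ‖w‖ ^ 2} :=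
    (isClosed_le (by fun_prop) (by fun_prop)).measurableSet
  have hnear : IntegrableOn (fun w : EuclideanSpace ℝ (Fin n) => ‖w‖ ^ (-((n : ℝ) + s)))
      ({w | 2 * |w i| ≤ ‖w‖ ^ 2} ∩ {w | ‖w‖ ≤ 1}) := by
    refine hint.integrableOn.mono' (measurable_norm.pow_const _).aestronglyMeasurable ?_
    refine (ae_restrict_iff' (hW.inter (measurableSet_le measurable_norm measurable_const))).2 ?_
    filter_upwards [hne] with w hw ⟨hw1, hw2⟩
    simp only [mem_ofPred_eq] at hw1 hw2
    have hle : ∀ j, |w j| ≤ ‖w‖ := fun j => PiLp.norm_apply_le w j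
    have hpos : 0 < ‖w‖ := (abs_pos.2 (hw i)).trans_le (hle i)
    have hmem : ∀ j, w j ∈ Icc (-1 : ℝ) 1 := fun j => abs_le.1 ((hle j).trans hw2)
    rw [Real.norm_of_nonneg (by positivity)]
    simp only [indicator_of_mem (hmem _)]
    set d : Fin n → ℝ := fun j => if j = i then -(1 + s + δ) else -(1 - δ / n) with hd
    calc ‖w‖ ^ (-((n : ℝ) + s)) ≤ ‖w‖ ^ (∑ j, d j) := by
          refine Real.rpow_le_rpow_of_exponent_ge hpos hw2 ?_
          have : ∑ j, d j = -(1 - δ / n) * n + (-(1 + s + δ) + (1 - δ / n)) := by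
            have h1 : ∀ j, d j = -(1 - δ / n) + if j = i then -(1 + s + δ) + (1 - δ / n) else 0 := by
              intro j; simp only [hd]; split_ifs <;> ring
            simp only [h1, Finset.sum_add_distrib, Finset.sum_ite_eq', Finset.mem_univ, if_true,
              Finset.sum_const, Finset.card_univ, Fintype.card_fin, nsmul_eq_mul]
            ring
          rw [this]
          have : δ / n * n = δ := by field_simp
          nlinarith
      _ = ∏ j, ‖w‖ ^ d j := Real.rpow_sum_of_pos hpos _ _
      _ ≤ ∏ j, |w j| ^ e j := by
          refine Finset.prod_le_prod (fun j _ => by positivity) fun j _ => ?_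
          by_cases hj : j = i
          · subst hj
            simp only [hd, he, if_true]
            have : ‖w‖ ^ (-(1 + s + δ)) = (‖w‖ ^ 2) ^ (-((1 + s + δ) / 2)) := by
              rw [← Real.rpow_natCast_mul hpos.le]; congr 1; push_cast; ring
            rw [this]
            refine Real.rpow_le_rpow_of_nonpos (abs_pos.2 (hw j)) ?_ (by linarith)
            linarith [abs_nonneg (w j)]
          · simp only [hd, he, hj, if_false]
            exact Real.rpow_le_rpow_of_nonpos (abs_pos.2 (hw j)) (hle j) (by linarith)
  refine (hnear.union ((integrableOn_norm_rpow_of_lt_norm hs0 one_pos))).mono_set ?_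
  intro w hw
  rcases le_or_gt ‖w‖ 1 with h | h
  exacts [Or.inl ⟨hw, h⟩, Or.inr h]

/-- The complement of the union of the ball centred at `0` through `x` and its reflection
through `x`. -/
def tangentGap {n : ℕ} (x : EuclideanSpace ℝ (Fin n)) : Set (EuclideanSpace ℝ (Fin n)) :=
  {y | ‖x‖ ≤ ‖y‖ ∧ ‖x‖ ≤ ‖x + x - y‖}

theorem measurableSet_tangentGap {n : ℕ} (x : EuclideanSpace ℝ (Fin n)) :
    MeasurableSet (tangentGap x) :=
  (measurableSet_le measurable_const measurable_norm).inter
    (measurableSet_le measurable_const (measurable_const.sub measurable_id).norm)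

theorem integrableOn_tangentGap_single {n : ℕ} {s : ℝ} (hs : s ∈ Ioo (0 : ℝ) 1) (i : Fin n) :
    IntegrableOn (fun y => ‖EuclideanSpace.single i (1 : ℝ) - y‖ ^ (-((n : ℝ) + s)))
      (tangentGap (EuclideanSpace.single i (1 : ℝ))) := by
  set e := EuclideanSpace.single i (1 : ℝ) with he
  have hne : ‖e‖ = 1 := by simp [he]
  have hW : MeasurableSet {w : EuclideanSpace ℝ (Fin n) | 2 * |w i| ≤ ‖w‖ ^ 2} :=
    (isClosed_le (by fun_prop) (by fun_prop)).measurableSet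
  have h := (integrable_indicator_iff hW).2 (integrableOn_norm_rpow_of_coord_le_sq hs i)
  rw [← integrable_indicator_iff (measurableSet_tangentGap e)]
  refine (h.comp_sub_left e).mono'
    ((measurable_norm_sub_rpow e _).indicator (measurableSet_tangentGap e)).aestronglyMeasurable
    (ae_of_all _ fun y => ?_)
  by_cases hy : y ∈ tangentGap e
  · have hyW : e - y ∈ {w : EuclideanSpace ℝ (Fin n) | 2 * |w i| ≤ ‖w‖ ^ 2} := by
      obtain ⟨h1, h2⟩ := hy
      rw [hne] at h1 h2
      have hin : inner ℝ e (e - y) = (e - y) i := by simp [he, EuclideanSpace.inner_single_left]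
      have e1 : ‖y‖ ^ 2 = 1 - 2 * (e - y) i + ‖e - y‖ ^ 2 := by
        have := norm_sub_sq_real e (e - y)
        rwa [hne, hin, sub_sub_cancel, one_pow] at this
      have e2 : ‖e + e - y‖ ^ 2 = 1 + 2 * (e - y) i + ‖e - y‖ ^ 2 := by
        have := norm_add_sq_real e (e - y)
        rwa [hne, hin, ← add_sub_assoc, one_pow] at this
      have : |2 * (e - y) i| ≤ ‖e - y‖ ^ 2 := abs_le.2 ⟨by nlinarith, by nlinarith⟩
      rwa [abs_mul, abs_two] at this
    rw [indicator_of_mem hy, indicator_of_mem hyW, Real.norm_of_nonneg (by positivity)]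
  · rw [indicator_of_notMem hy, norm_zero]
    exact indicator_nonneg (fun _ _ => by positivity) _

theorem exists_linearIsometryEquiv_eq_smul {n : ℕ} {e x : EuclideanSpace ℝ (Fin n)} (he : ‖e‖ = 1)
    (hx : 0 < ‖x‖) :
    ∃ T : EuclideanSpace ℝ (Fin n) ≃ₗᵢ[ℝ] EuclideanSpace ℝ (Fin n), x = ‖x‖ • T e := by
  refine ⟨(ℝ ∙ (e - ‖x‖⁻¹ • x))ᗮ.reflection, ?_⟩
  rw [Submodule.reflection_sub, smul_inv_smul₀ hx.ne']
  rw [he, norm_smul, norm_inv, norm_norm, inv_mul_cancel₀ hx.ne']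

theorem norm_smul_map_sub_rpow {n : ℕ} (T : EuclideanSpace ℝ (Fin n) ≃ₗᵢ[ℝ] EuclideanSpace ℝ (Fin n))
    (e z : EuclideanSpace ℝ (Fin n)) {ρ : ℝ} (hρ : 0 < ρ) (p : ℝ) :
    ‖ρ • T e - ρ • T z‖ ^ p = ρ ^ p * ‖e - z‖ ^ p := by
  rw [← smul_sub, norm_smul, ← map_sub, T.norm_map, Real.norm_of_nonneg hρ.le,
    Real.mul_rpow hρ.le (norm_nonneg _)]

theorem integral_eq_mul_integral_comp_smul_map {n : ℕ}
    (T : EuclideanSpace ℝ (Fin n) ≃ₗᵢ[ℝ] EuclideanSpace ℝ (Fin n)) {ρ : ℝ} (hρ : 0 < ρ)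
    (f : EuclideanSpace ℝ (Fin n) → ℝ) : ∫ y, f y = ρ ^ n * ∫ z, f (ρ • T z) := by
  have h1 := (LinearIsometryEquiv.measurePreserving T).integral_comp T.toHomeomorph.measurableEmbedding
    (fun y => f (ρ • y))
  rw [h1, Measure.integral_comp_smul, finrank_euclideanSpace_fin, abs_of_pos (by positivity),
    smul_eq_mul, mul_inv_cancel_left₀ (by positivity)]

theorem integrable_comp_smul_map_iff {n : ℕ}
    (T : EuclideanSpace ℝ (Fin n) ≃ₗᵢ[ℝ] EuclideanSpace ℝ (Fin n)) {ρ : ℝ} (hρ : 0 < ρ)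
    (f : EuclideanSpace ℝ (Fin n) → ℝ) : Integrable (fun z => f (ρ • T z)) ↔ Integrable f := by
  rw [← integrable_comp_smul_iff volume f hρ.ne']
  exact (LinearIsometryEquiv.measurePreserving T).integrable_comp_emb
    T.toHomeomorph.measurableEmbedding (g := fun y => f (ρ • y))

theorem setIntegral_norm_smul_map_sub_rpow {n : ℕ} (s : ℝ)
    (T : EuclideanSpace ℝ (Fin n) ≃ₗᵢ[ℝ] EuclideanSpace ℝ (Fin n)) {ρ : ℝ} (hρ : 0 < ρ)
    (e : EuclideanSpace ℝ (Fin n)) {S : Set (EuclideanSpace ℝ (Fin n))} (hS : MeasurableSet S) :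
    ∫ y in S, ‖ρ • T e - y‖ ^ (-((n : ℝ) + s)) =
      ρ ^ (-s) * ∫ z in (fun z => ρ • T z) ⁻¹' S, ‖e - z‖ ^ (-((n : ℝ) + s)) := by
  have hm : Measurable fun z => ρ • T z := (T.continuous.const_smul ρ).measurable
  rw [← integral_indicator hS, ← integral_indicator (hm hS),
    integral_eq_mul_integral_comp_smul_map T hρ]
  have h : ∀ z, S.indicator (fun y => ‖ρ • T e - y‖ ^ (-((n : ℝ) + s))) (ρ • T z) =
      ρ ^ (-((n : ℝ) + s)) *
        ((fun z => ρ • T z) ⁻¹' S).indicator (fun z => ‖e - z‖ ^ (-((n : ℝ) + s))) z := by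
    intro z
    by_cases hz : ρ • T z ∈ S
    · have hz' : z ∈ (fun z => ρ • T z) ⁻¹' S := hz
      rw [indicator_of_mem hz, indicator_of_mem hz', norm_smul_map_sub_rpow T e z hρ]
    · have hz' : z ∉ (fun z => ρ • T z) ⁻¹' S := hz
      rw [indicator_of_notMem hz, indicator_of_notMem hz', mul_zero]
  simp only [h]
  rw [integral_const_mul, ← mul_assoc, ← Real.rpow_natCast, ← Real.rpow_add hρ]
  congr 2
  ring

theorem integrableOn_norm_smul_map_sub_rpow {n : ℕ} {s : ℝ}
    (T : EuclideanSpace ℝ (Fin n) ≃ₗᵢ[ℝ] EuclideanSpace ℝ (Fin n)) {ρ : ℝ} (hρ : 0 < ρ)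
    (e : EuclideanSpace ℝ (Fin n)) {S : Set (EuclideanSpace ℝ (Fin n))} (hS : MeasurableSet S)
    (h : IntegrableOn (fun z => ‖e - z‖ ^ (-((n : ℝ) + s))) ((fun z => ρ • T z) ⁻¹' S)) :
    IntegrableOn (fun y => ‖ρ • T e - y‖ ^ (-((n : ℝ) + s))) S := by
  have hm : Measurable fun z => ρ • T z := (T.continuous.const_smul ρ).measurable
  rw [← integrable_indicator_iff hS, ← integrable_comp_smul_map_iff T hρ]
  refine (((integrable_indicator_iff (hm hS)).2 h).const_mul (ρ ^ (-((n : ℝ) + s)))).congr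
    (ae_of_all _ fun z => ?_)
  by_cases hz : ρ • T z ∈ S
  · have hz' : z ∈ (fun z => ρ • T z) ⁻¹' S := hz
    simp only [indicator_of_mem hz, indicator_of_mem hz', norm_smul_map_sub_rpow T e z hρ]
  · have hz' : z ∉ (fun z => ρ • T z) ⁻¹' S := hz
    simp only [indicator_of_notMem hz, indicator_of_notMem hz', mul_zero]

theorem preimage_smul_map_tangentGap {n : ℕ}
    (T : EuclideanSpace ℝ (Fin n) ≃ₗᵢ[ℝ] EuclideanSpace ℝ (Fin n)) {ρ : ℝ} (hρ : 0 < ρ)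
    (e : EuclideanSpace ℝ (Fin n)) :
    (fun z => ρ • T z) ⁻¹' tangentGap (ρ • T e) = tangentGap e := by
  ext z
  simp only [tangentGap, mem_preimage, mem_ofPred_eq, ← smul_add, ← smul_sub, ← map_add, ← map_sub,
    norm_smul, T.norm_map, Real.norm_of_nonneg hρ.le, mul_le_mul_iff_right₀ hρ]

theorem preimage_smul_map_ball {n : ℕ}
    (T : EuclideanSpace ℝ (Fin n) ≃ₗᵢ[ℝ] EuclideanSpace ℝ (Fin n)) {ρ : ℝ} (hρ : 0 < ρ) (r : ℝ) :
    (fun z => ρ • T z) ⁻¹' ball 0 r = ball 0 (r / ρ) := by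
  ext z
  simp [norm_smul, abs_of_pos hρ, lt_div_iff₀' hρ]

theorem integrableOn_tangentGap {n : ℕ} {s : ℝ} (hs : s ∈ Ioo (0 : ℝ) 1)
    {x : EuclideanSpace ℝ (Fin n)} (hx : 0 < ‖x‖) :
    IntegrableOn (fun y => ‖x - y‖ ^ (-((n : ℝ) + s))) (tangentGap x) := by
  obtain ⟨i⟩ : Nonempty (Fin n) := by
    by_contra h
    rw [not_nonempty_iff] at h
    simp [EuclideanSpace.norm_eq] at hx
  obtain ⟨T, hT⟩ := exists_linearIsometryEquiv_eq_smul (e := EuclideanSpace.single i (1 : ℝ))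
    (by simp) hx
  rw [hT]
  apply integrableOn_norm_smul_map_sub_rpow T hx _ (measurableSet_tangentGap _)
  rw [preimage_smul_map_tangentGap T hx]
  exact integrableOn_tangentGap_single hs i

theorem integrableOn_norm_sub_rpow {n : ℕ} {s ε : ℝ} (hs : 0 < s) (hε : 0 < ε)
    (x : EuclideanSpace ℝ (Fin n)) :
    IntegrableOn (fun y => ‖x - y‖ ^ (-((n : ℝ) + s))) {y | ε < dist y x} := by
  have h := ((integrable_indicator_iff (measurableSet_lt measurable_const measurable_norm)).2
    (integrableOn_norm_rpow_of_lt_norm (n := n) hs hε)).comp_sub_left x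
  have hU : MeasurableSet {y : EuclideanSpace ℝ (Fin n) | ε < dist y x} :=
    measurableSet_lt measurable_const (measurable_id.dist measurable_const)
  rw [← integrable_indicator_iff hU]
  refine h.congr (ae_of_all _ fun y => ?_)
  simp only [indicator_apply, mem_ofPred_eq, dist_comm _ x, dist_eq_norm]

theorem tendsto_setIntegral_lt_dist {X : Type*} [PseudoMetricSpace X] [MeasurableSpace X]
    [OpensMeasurableSpace X] {μ : Measure X} {f : X → ℝ} (hf : Integrable f μ) {x : X}
    (hx : ∀ y, dist y x = 0 → f y = 0) :
    Tendsto (fun ε : ℝ => ∫ y in {y | ε < dist y x}, f y ∂μ) (nhdsWithin 0 (Ioi 0))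
      (nhds (∫ y, f y ∂μ)) := by
  have hU : ∀ ε : ℝ, MeasurableSet {y | ε < dist y x} := fun ε =>
    (isOpen_lt continuous_const (continuous_id.dist continuous_const)).measurableSet
  simp only [← integral_indicator (hU _)]
  refine tendsto_integral_filter_of_dominated_convergence (fun y => ‖f y‖)
    (Eventually.of_forall fun ε => hf.aestronglyMeasurable.indicator (hU ε))
    (Eventually.of_forall fun ε => ae_of_all _ fun y => norm_indicator_le_norm_self _ _) hf.norm
    (ae_of_all _ fun y => ?_)
  refine tendsto_const_nhds.congr' ?_
  rcases (dist_nonneg (x := y) (y := x)).eq_or_lt with h | h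
  · refine Eventually.of_forall fun ε => ?_
    rw [hx y h.symm, eq_comm]
    exact indicator_apply_eq_zero.2 fun _ => hx y h.symm
  · filter_upwards [mem_nhdsWithin_of_mem_nhds (Iio_mem_nhds h)] with ε hε
    exact (indicator_of_mem (s := {y | ε < dist y x}) hε f).symm

theorem setIntegral_ball_reflect_eq {n : ℕ} (s ε : ℝ) (x : EuclideanSpace ℝ (Fin n)) :
    ∫ y in {y | ε < dist y x},
        {y | ‖x + x - y‖ < ‖x‖}.indicator (fun y => ‖x - y‖ ^ (-((n : ℝ) + s))) y =
      ∫ y in {y | ε < dist y x}, (ball 0 ‖x‖).indicator (fun y => ‖x - y‖ ^ (-((n : ℝ) + s))) y := by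
  have hU : MeasurableSet {y : EuclideanSpace ℝ (Fin n) | ε < dist y x} :=
    measurableSet_lt measurable_const (measurable_id.dist measurable_const)
  rw [← integral_indicator hU, ← integral_indicator hU, ← integral_sub_left_eq_self _ _ (x + x)]
  classical
  congr 1
  ext y
  have h : ‖x - (x + x - y)‖ = ‖x - y‖ := by rw [← norm_neg]; congr 1; abel
  simp only [indicator_apply, mem_ofPred_eq, mem_ball_zero_iff, dist_comm _ x, dist_eq_norm, h,
    sub_sub_cancel]

theorem hasFracMeanCurvAt_of_sign_eq {n : ℕ} {s : ℝ} (hs : s ∈ Ioo (0 : ℝ) 1)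
    {E : Set (EuclideanSpace ℝ (Fin n))} {x : EuclideanSpace ℝ (Fin n)} (hx : 0 < ‖x‖) (σ : ℝ)
    {φ : EuclideanSpace ℝ (Fin n) → ℝ}
    (hφ : Integrable fun y => φ y * ‖x - y‖ ^ (-((n : ℝ) + s)))
    (hE : ∀ y, Eᶜ.indicator (fun _ => (1 : ℝ)) y - E.indicator (fun _ => (1 : ℝ)) y =
      σ * ((ball 0 ‖x‖)ᶜ.indicator (fun _ => (1 : ℝ)) y
        - (ball 0 ‖x‖).indicator (fun _ => (1 : ℝ)) y) + φ y) :
    HasFracMeanCurvAt n s E x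
      (σ * (∫ y in tangentGap x, ‖x - y‖ ^ (-((n : ℝ) + s)))
        + ∫ y, φ y * ‖x - y‖ ^ (-((n : ℝ) + s))) := by
  set k : EuclideanSpace ℝ (Fin n) → ℝ := fun y => ‖x - y‖ ^ (-((n : ℝ) + s)) with hk
  have hkx : ∀ y, dist y x = 0 → k y = 0 := fun y hy => by
    rw [dist_comm, dist_eq_norm] at hy
    simp only [hk, hy]
    exact Real.zero_rpow (by linarith [hs.1, n.cast_nonneg (α := ℝ)])
  have hD := measurableSet_tangentGap x
  have hDk : Integrable ((tangentGap x).indicator k) :=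
    (integrable_indicator_iff hD).2 (integrableOn_tangentGap hs hx)
  have hB' : MeasurableSet {y : EuclideanSpace ℝ (Fin n) | ‖x + x - y‖ < ‖x‖} :=
    (isOpen_lt (by fun_prop) (by fun_prop)).measurableSet
  have hlim := ((tendsto_setIntegral_lt_dist hDk (x := x) fun y hy =>
      indicator_apply_eq_zero.2 fun _ => hkx y hy).const_mul σ).add
    (tendsto_setIntegral_lt_dist hφ (x := x) fun y hy => by
      change φ y * k y = 0
      rw [hkx y hy, mul_zero])
  rw [integral_indicator hD] at hlim
  refine hlim.congr' ?_
  filter_upwards [self_mem_nhdsWithin] with ε (hε : 0 < ε)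
  have hkU : IntegrableOn k {y | ε < dist y x} := integrableOn_norm_sub_rpow hs.1 hε x
  have hkey : ∀ y, (Eᶜ.indicator (fun _ => (1 : ℝ)) y - E.indicator (fun _ => (1 : ℝ)) y) * k y =
      (σ * (tangentGap x).indicator k y + φ y * k y)
      + σ * ({y | ‖x + x - y‖ < ‖x‖}.indicator k y - (ball 0 ‖x‖).indicator k y) := by
    intro y
    have hor : ‖y‖ < ‖x‖ → ¬ ‖x + x - y‖ < ‖x‖ := fun h1 h2 => by
      have h3 := norm_le_norm_sub_add (x + x) y
      rw [show ‖x + x‖ = 2 * ‖x‖ by rw [← two_smul ℝ, norm_smul, Real.norm_two]] at h3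
      linarith
    classical
    rw [hE]
    simp only [indicator_apply, tangentGap, mem_ofPred_eq, mem_compl_iff, mem_ball_zero_iff,
      ← not_lt]
    by_cases h1 : ‖y‖ < ‖x‖
    · simp only [h1, hor h1, not_true, false_and, if_true, if_false]; ring
    · by_cases h2 : ‖x + x - y‖ < ‖x‖ <;>
        simp only [h1, h2, not_true, not_false_eq_true, and_false, and_true, if_true, if_false] <;> ring
  have hi1 : IntegrableOn (fun y => σ * (tangentGap x).indicator k y) {y | ε < dist y x} :=
    (hDk.const_mul σ).integrableOn
  have hi2 : IntegrableOn (fun y => {y | ‖x + x - y‖ < ‖x‖}.indicator k y) {y | ε < dist y x} :=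
    hkU.integrable.indicator hB'
  have hi3 : IntegrableOn (fun y => (ball 0 ‖x‖).indicator k y) {y | ε < dist y x} :=
    hkU.integrable.indicator measurableSet_ball
  change _ = ∫ y in {y | ε < dist y x},
    (Eᶜ.indicator (fun _ => (1 : ℝ)) y - E.indicator (fun _ => (1 : ℝ)) y) * k y
  simp only [hkey]
  have hi12 : IntegrableOn (fun y => σ * (tangentGap x).indicator k y + φ y * k y)
      {y | ε < dist y x} := hi1.add hφ.integrableOn
  have hi23 : IntegrableOn (fun y => σ * ({y | ‖x + x - y‖ < ‖x‖}.indicator k y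
      - (ball 0 ‖x‖).indicator k y)) {y | ε < dist y x} := (hi2.sub hi3).const_mul σ
  rw [integral_add hi12 hi23, integral_add hi1 hφ.integrableOn, integral_const_mul, integral_const_mul,
    integral_sub hi2 hi3, setIntegral_ball_reflect_eq, sub_self, mul_zero, add_zero]

theorem hasFracMeanCurvAt_smul_map {n : ℕ} {s : ℝ} (hs : s ∈ Ioo (0 : ℝ) 1)
    {E S : Set (EuclideanSpace ℝ (Fin n))} {e : EuclideanSpace ℝ (Fin n)} (he : ‖e‖ = 1)
    (T : EuclideanSpace ℝ (Fin n) ≃ₗᵢ[ℝ] EuclideanSpace ℝ (Fin n)) {ρ : ℝ} (hρ : 0 < ρ) (σ : ℝ)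
    (hS : MeasurableSet S) {ε : ℝ} (hε : 0 < ε) (hSε : ∀ y ∈ S, ε < dist y (ρ • T e))
    (hE : ∀ y, Eᶜ.indicator (fun _ => (1 : ℝ)) y - E.indicator (fun _ => (1 : ℝ)) y =
      σ * ((ball 0 ρ)ᶜ.indicator (fun _ => (1 : ℝ)) y - (ball 0 ρ).indicator (fun _ => (1 : ℝ)) y)
        + S.indicator (fun _ => (2 : ℝ)) y) :
    HasFracMeanCurvAt n s E (ρ • T e)
      (ρ ^ (-s) * (σ * (∫ y in tangentGap e, ‖e - y‖ ^ (-((n : ℝ) + s)))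
        + 2 * ∫ y in (fun z => ρ • T z) ⁻¹' S, ‖e - y‖ ^ (-((n : ℝ) + s)))) := by
  have hx : ‖ρ • T e‖ = ρ := by
    rw [norm_smul, T.norm_map, he, mul_one, Real.norm_of_nonneg hρ.le]
  have hmul : ∀ y, S.indicator (fun _ => (2 : ℝ)) y * ‖ρ • T e - y‖ ^ (-((n : ℝ) + s)) =
      S.indicator (fun y => 2 * ‖ρ • T e - y‖ ^ (-((n : ℝ) + s))) y := fun y => by
    by_cases hy : y ∈ S <;> simp [hy]
  have hint : IntegrableOn (fun y => 2 * ‖ρ • T e - y‖ ^ (-((n : ℝ) + s))) S :=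
    ((integrableOn_norm_sub_rpow hs.1 hε (ρ • T e)).mono_set hSε).const_mul 2
  have h := hasFracMeanCurvAt_of_sign_eq hs (x := ρ • T e) (by rwa [hx]) σ
    (φ := S.indicator fun _ => (2 : ℝ))
    (by simp only [hmul]; exact (integrable_indicator_iff hS).2 hint) (by rwa [hx])
  convert h using 1
  simp only [hmul]
  rw [integral_indicator hS, integral_const_mul, setIntegral_norm_smul_map_sub_rpow s T hρ e hS,
    setIntegral_norm_smul_map_sub_rpow s T hρ e (measurableSet_tangentGap _),
    preimage_smul_map_tangentGap T hρ]
  ring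

theorem hasFracMeanCurvAt_annulus_inner {n : ℕ} {s r R : ℝ} (hs : s ∈ Ioo (0 : ℝ) 1) (hr : 0 < r)
    (hrR : r < R) {e x : EuclideanSpace ℝ (Fin n)} (he : ‖e‖ = 1) (hx : ‖x‖ = r) :
    HasFracMeanCurvAt n s (ball 0 R \ ball 0 r) x
      (r ^ (-s) * (-1 * (∫ y in tangentGap e, ‖e - y‖ ^ (-((n : ℝ) + s)))
        + 2 * ∫ y in (ball 0 (R / r))ᶜ, ‖e - y‖ ^ (-((n : ℝ) + s)))) := by
  obtain ⟨T, hT⟩ := exists_linearIsometryEquiv_eq_smul he (x := x) (hx.symm ▸ hr)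
  rw [hx] at hT
  rw [← preimage_smul_map_ball T hr, ← preimage_compl, hT]
  refine hasFracMeanCurvAt_smul_map hs he T hr _ measurableSet_ball.compl
    (half_pos (sub_pos.2 hrR)) (fun y hy => ?_) fun y => ?_
  · rw [mem_compl_iff, mem_ball_zero_iff, not_lt] at hy
    rw [← hT, dist_eq_norm]
    linarith [norm_sub_norm_le y x]
  · by_cases h1 : ‖y‖ < r
    · have h2 : ‖y‖ < R := h1.trans hrR
      simp [indicator, h1, h2]
    · by_cases h2 : ‖y‖ < R <;> simp [indicator, h1, h2]
      norm_num

theorem hasFracMeanCurvAt_annulus_outer {n : ℕ} {s r R : ℝ} (hs : s ∈ Ioo (0 : ℝ) 1) (hR : 0 < R)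
    (hrR : r < R) {e x : EuclideanSpace ℝ (Fin n)} (he : ‖e‖ = 1) (hx : ‖x‖ = R) :
    HasFracMeanCurvAt n s (ball 0 R \ ball 0 r) x
      (R ^ (-s) * (1 * (∫ y in tangentGap e, ‖e - y‖ ^ (-((n : ℝ) + s)))
        + 2 * ∫ y in ball 0 (r / R), ‖e - y‖ ^ (-((n : ℝ) + s)))) := by
  obtain ⟨T, hT⟩ := exists_linearIsometryEquiv_eq_smul he (x := x) (hx.symm ▸ hR)
  rw [hx] at hT
  rw [← preimage_smul_map_ball T hR, hT]
  refine hasFracMeanCurvAt_smul_map hs he T hR _ measurableSet_ball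
    (half_pos (sub_pos.2 hrR)) (fun y hy => ?_) fun y => ?_
  · rw [mem_ball_zero_iff] at hy
    rw [← hT, dist_comm, dist_eq_norm]
    linarith [norm_sub_norm_le x y]
  · by_cases h1 : ‖y‖ < r
    · have h2 : ‖y‖ < R := h1.trans hrR
      simp [indicator, h1, h2]
      norm_num
    · by_cases h2 : ‖y‖ < R <;> simp [indicator, h1, h2]

theorem continuousAt_setIntegral_ball {n : ℕ} {f : EuclideanSpace ℝ (Fin n) → ℝ}
    (hf : Integrable f) {t : ℝ} (ht : t ≠ 0) : ContinuousAt (fun t => ∫ y in ball 0 t, f y) t := by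
  simp only [← integral_indicator measurableSet_ball]
  refine tendsto_integral_filter_of_dominated_convergence (fun y => ‖f y‖)
    (Eventually.of_forall fun u => hf.aestronglyMeasurable.indicator measurableSet_ball)
    (Eventually.of_forall fun u => ae_of_all _ fun y => norm_indicator_le_norm_self _ _) hf.norm ?_
  have hsph : ∀ᵐ y : EuclideanSpace ℝ (Fin n), y ∉ sphere 0 t :=
    measure_eq_zero_iff_ae_notMem.1 (Measure.addHaar_sphere_of_ne_zero volume 0 ht)
  filter_upwards [hsph] with y hy
  rw [mem_sphere_zero_iff_norm] at hy
  refine tendsto_const_nhds.congr' ?_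
  rcases lt_or_gt_of_ne hy with h | h
  · filter_upwards [Ioi_mem_nhds h] with u hu
    rw [indicator_of_mem (mem_ball_zero_iff.2 h), indicator_of_mem (mem_ball_zero_iff.2 hu)]
  · filter_upwards [Iio_mem_nhds h] with u hu
    rw [indicator_of_notMem fun h' => h.not_gt (mem_ball_zero_iff.1 h'),
      indicator_of_notMem fun h' => (not_lt_of_gt hu) (mem_ball_zero_iff.1 h')]

theorem continuousAt_setIntegral_ball_of_integrableOn {n : ℕ} {f : EuclideanSpace ℝ (Fin n) → ℝ}
    {t u : ℝ} (hf : IntegrableOn f (ball 0 u)) (ht : t ≠ 0) (htu : t < u) :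
    ContinuousAt (fun t => ∫ y in ball 0 t, f y) t := by
  refine (continuousAt_setIntegral_ball ((integrable_indicator_iff measurableSet_ball).2 hf)
    ht).congr ?_
  filter_upwards [Iio_mem_nhds htu] with v hv
  exact setIntegral_congr_fun measurableSet_ball fun y hy =>
    indicator_of_mem (ball_subset_ball (le_of_lt hv) hy) f

theorem continuousAt_setIntegral_compl_ball_of_integrableOn {n : ℕ}
    {f : EuclideanSpace ℝ (Fin n) → ℝ} {t u : ℝ} (hf : IntegrableOn f (ball 0 u)ᶜ) (ht : t ≠ 0)
    (hut : u < t) : ContinuousAt (fun t => ∫ y in (ball 0 t)ᶜ, f y) t := by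
  have hi := (integrable_indicator_iff measurableSet_ball.compl).2 hf
  refine ((continuousAt_const (y := ∫ y, (ball 0 u)ᶜ.indicator f y)).sub
    (continuousAt_setIntegral_ball hi ht)).congr ?_
  filter_upwards [Ioi_mem_nhds hut] with v hv
  rw [Pi.sub_apply, ← setIntegral_compl measurableSet_ball hi]
  exact setIntegral_congr_fun measurableSet_ball.compl fun y hy =>
    indicator_of_mem (compl_subset_compl.2 (ball_subset_ball (le_of_lt hv)) hy) f

theorem tendsto_setIntegral_compl_ball_atTop {n : ℕ} {f : EuclideanSpace ℝ (Fin n) → ℝ} {u : ℝ}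
    (hf : IntegrableOn f (ball 0 u)ᶜ) :
    Tendsto (fun t => ∫ y in (ball 0 t)ᶜ, f y) atTop (nhds 0) := by
  have hi := (integrable_indicator_iff measurableSet_ball.compl).2 hf
  simp only [← integral_indicator measurableSet_ball.compl]
  rw [← integral_zero (EuclideanSpace ℝ (Fin n)) ℝ]
  have hsub : ∀ᶠ t in atTop, ∀ y, (ball 0 t)ᶜ.indicator f y =
      (ball 0 t)ᶜ.indicator ((ball 0 u)ᶜ.indicator f) y := by
    filter_upwards [eventually_ge_atTop u] with t ht y
    rw [indicator_indicator, inter_eq_left.2 (compl_subset_compl.2 (ball_subset_ball ht))]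
  refine tendsto_integral_filter_of_dominated_convergence (fun y => ‖(ball 0 u)ᶜ.indicator f y‖)
    ?_ ?_ hi.norm (ae_of_all _ fun y => ?_)
  · filter_upwards [hsub] with t ht
    rw [funext ht]
    exact hi.aestronglyMeasurable.indicator measurableSet_ball.compl
  · filter_upwards [hsub] with t ht
    refine ae_of_all _ fun y => ?_
    rw [ht]
    exact norm_indicator_le_norm_self _ _
  · refine tendsto_const_nhds.congr' ?_
    filter_upwards [eventually_gt_atTop ‖y‖] with t ht
    have hy : y ∉ (ball 0 t)ᶜ := notMem_compl_iff.2 (mem_ball_zero_iff.2 ht)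
    exact (indicator_of_notMem hy f).symm

theorem setIntegral_norm_sub_rpow_pos {n : ℕ} {p : ℝ} {x a : EuclideanSpace ℝ (Fin n)} {δ : ℝ}
    {S : Set (EuclideanSpace ℝ (Fin n))} (hS : IntegrableOn (fun y => ‖x - y‖ ^ p) S) (hδ : 0 < δ)
    (ha : ball a δ ⊆ S) (hx : x ∉ ball a δ) : 0 < ∫ y in S, ‖x - y‖ ^ p := by
  rw [setIntegral_pos_iff_support_of_nonneg_ae (ae_of_all _ fun y => by positivity) hS]
  refine (measure_ball_pos volume a hδ).trans_le (measure_mono fun y hy => ⟨?_, ha hy⟩)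
  have : x - y ≠ 0 := sub_ne_zero.2 fun h => hx (h ▸ hy)
  exact (Real.rpow_pos_of_pos (norm_pos_iff.2 this) p).ne'

theorem existsUnique_balance {c s : ℝ} (hc : 0 < c) (hs : 0 < s) {K L : ℝ → ℝ}
    (hK : ∀ u ∈ Ioi (1 : ℝ), 0 ≤ K u) (hKanti : AntitoneOn K (Ioi 1))
    (hKcont : ContinuousOn K (Ioi 1)) (hKlim : Tendsto K atTop (nhds 0))
    (hL : ∀ t ∈ Ioo (0 : ℝ) 1, 0 < L t) (hLmono : MonotoneOn L (Ioo 0 1))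
    (hLcont : ContinuousOn L (Ioo 0 1)) :
    ∃! t, t ∈ Ioo (0 : ℝ) 1 ∧ 2 * K t⁻¹ - c + t ^ (1 + s) * (c + 2 * L t) = 0 := by
  set G : ℝ → ℝ := fun t => 2 * K t⁻¹ - c + t ^ (1 + s) * (c + 2 * L t) with hG
  have hinv : MapsTo (fun t : ℝ => t⁻¹) (Ioo 0 1) (Ioi 1) := fun t ht =>
    (one_lt_inv₀ ht.1).2 ht.2
  have hhalf : (1 / 2 : ℝ) ∈ Ioo (0 : ℝ) 1 := by constructor <;> norm_num
  have hmono : StrictMonoOn G (Ioo 0 1) := fun a ha b hb hab => by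
    have h1 : K a⁻¹ ≤ K b⁻¹ :=
      hKanti (hinv hb) (hinv ha) (inv_anti₀ ha.1 hab.le)
    have h2 : a ^ (1 + s) < b ^ (1 + s) := Real.rpow_lt_rpow ha.1.le hab (by linarith)
    have h3 : L a ≤ L b := hLmono ha hb hab.le
    have h4 : 0 < L a := hL a ha
    have h5 : 0 < a ^ (1 + s) := Real.rpow_pos_of_pos ha.1 _
    have h6 : a ^ (1 + s) * (c + 2 * L a) < b ^ (1 + s) * (c + 2 * L b) :=
      mul_lt_mul h2 (by linarith) (by linarith) (by linarith)
    simp only [hG]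
    linarith
  have hcont : ContinuousOn G (Ioo 0 1) := by
    have h1 : ContinuousOn (fun t : ℝ => K t⁻¹) (Ioo 0 1) :=
      hKcont.comp (continuousOn_id.inv₀ fun t ht => ht.1.ne') hinv
    have h2 : ContinuousOn (fun t : ℝ => t ^ (1 + s)) (Ioo 0 1) :=
      (Real.continuous_rpow_const (by linarith)).continuousOn
    exact ((continuousOn_const.mul h1).sub continuousOn_const).add
      (h2.mul (continuousOn_const.add (continuousOn_const.mul hLcont)))
  have hpow : Continuous fun t : ℝ => t ^ (1 + s) * (c + 2 * L (1 / 2)) :=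
    (Real.continuous_rpow_const (by linarith)).mul_const _
  obtain ⟨a, ha, hGa⟩ : ∃ a ∈ Ioo (0 : ℝ) 1, G a ≤ 0 := by
    have hlim : Tendsto (fun t : ℝ => 2 * K t⁻¹ - c + t ^ (1 + s) * (c + 2 * L (1 / 2)))
        (nhdsWithin 0 (Ioi 0)) (nhds (-c)) := by
      have h1 := ((hKlim.comp tendsto_inv_nhdsGT_zero).const_mul 2).sub_const c
      have h2 := (hpow.tendsto 0).mono_left (nhdsWithin_le_nhds (s := Ioi 0))
      have h3 : -c = 2 * 0 - c + 0 ^ (1 + s) * (c + 2 * L (1 / 2)) := by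
        rw [Real.zero_rpow (by linarith)]
        ring
      rw [h3]
      exact h1.add h2
    obtain ⟨t, ht, ht'⟩ := ((hlim.eventually_lt_const (neg_lt_zero.2 hc)).and
      (Ioo_mem_nhdsGT hhalf.1)).exists
    have ht1 : t ∈ Ioo (0 : ℝ) 1 := ⟨ht'.1, ht'.2.trans hhalf.2⟩
    have h1 := mul_le_mul_of_nonneg_left (hLmono ht1 hhalf ht'.2.le)
      (Real.rpow_nonneg ht1.1.le (1 + s))
    refine ⟨t, ht1, ?_⟩
    simp only [hG]
    linarith
  obtain ⟨b, hb, hGb⟩ : ∃ b ∈ Ioo (0 : ℝ) 1, 0 ≤ G b := by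
    have hlim : Tendsto (fun t : ℝ => t ^ (1 + s) * (c + 2 * L (1 / 2)))
        (nhdsWithin 1 (Iio 1)) (nhds (c + 2 * L (1 / 2))) := by
      have h2 := (hpow.tendsto 1).mono_left (nhdsWithin_le_nhds (s := Iio 1))
      rwa [Real.one_rpow, one_mul] at h2
    obtain ⟨t, ht, ht'⟩ := ((hlim.eventually_const_lt
      (show c < c + 2 * L (1 / 2) by linarith [hL _ hhalf])).and (Ioo_mem_nhdsLT hhalf.2)).exists
    have ht1 : t ∈ Ioo (0 : ℝ) 1 := ⟨hhalf.1.trans ht'.1, ht'.2⟩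
    have h1 := mul_le_mul_of_nonneg_left (hLmono hhalf ht1 ht'.1.le)
      (Real.rpow_nonneg ht1.1.le (1 + s))
    refine ⟨t, ht1, ?_⟩
    simp only [hG]
    linarith [hK _ (hinv ht1)]
  obtain ⟨t, ht, hGt⟩ := isPreconnected_Ioo.intermediate_value ha hb hcont ⟨hGa, hGb⟩
  exact ⟨t, ⟨ht, hGt⟩, fun u hu => hmono.injOn hu.1 ht (hu.2.trans hGt.symm)⟩

theorem annulus_balance_eq {r R s : ℝ} (hr : 0 < r) (hR : 0 < R) (c k l : ℝ) :
    R * (r ^ (-s) * (-1 * c + 2 * k)) + r * (R ^ (-s) * (1 * c + 2 * l)) =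
      R * r ^ (-s) * (2 * k - c + (r / R) ^ (1 + s) * (c + 2 * l)) := by
  have h : r * R ^ (-s) = R * r ^ (-s) * (r / R) ^ (1 + s) := by
    rw [Real.rpow_add (by positivity), Real.rpow_one, Real.div_rpow hr.le hR.le,
      Real.rpow_neg hr.le, Real.rpow_neg hR.le]
    have := (Real.rpow_pos_of_pos hr s).ne'
    have := (Real.rpow_pos_of_pos hR s).ne'
    field_simp
  linear_combination (c + 2 * l) * h

theorem existsUnique_annulus_balance {n : ℕ} {s : ℝ} (hs : s ∈ Ioo (0 : ℝ) 1)
    {e : EuclideanSpace ℝ (Fin n)} (he : ‖e‖ = 1) :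
    ∃! t, t ∈ Ioo (0 : ℝ) 1 ∧
      2 * (∫ y in (ball 0 t⁻¹)ᶜ, ‖e - y‖ ^ (-((n : ℝ) + s)))
        - (∫ y in tangentGap e, ‖e - y‖ ^ (-((n : ℝ) + s)))
        + t ^ (1 + s) * ((∫ y in tangentGap e, ‖e - y‖ ^ (-((n : ℝ) + s)))
          + 2 * ∫ y in ball 0 t, ‖e - y‖ ^ (-((n : ℝ) + s))) = 0 := by
  have hball : ∀ t < 1, IntegrableOn (fun y => ‖e - y‖ ^ (-((n : ℝ) + s))) (ball 0 t) :=
    fun t ht => (integrableOn_norm_sub_rpow hs.1 (half_pos (sub_pos.2 ht)) e).mono_set fun y hy => by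
      rw [mem_ball_zero_iff] at hy
      rw [mem_ofPred_eq, dist_comm, dist_eq_norm]
      linarith [norm_sub_norm_le e y]
  have hcompl : ∀ t > 1, IntegrableOn (fun y => ‖e - y‖ ^ (-((n : ℝ) + s))) (ball 0 t)ᶜ :=
    fun t ht => (integrableOn_norm_sub_rpow hs.1 (half_pos (sub_pos.2 ht)) e).mono_set fun y hy => by
      rw [mem_compl_iff, mem_ball_zero_iff, not_lt] at hy
      rw [mem_ofPred_eq, dist_eq_norm]
      linarith [norm_sub_norm_le y e]
  have hnonneg : ∀ y, 0 ≤ ‖e - y‖ ^ (-((n : ℝ) + s)) := fun y => by positivity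
  refine existsUnique_balance (K := fun u => ∫ y in (ball 0 u)ᶜ, ‖e - y‖ ^ (-((n : ℝ) + s)))
    (L := fun t => ∫ y in ball 0 t, ‖e - y‖ ^ (-((n : ℝ) + s)))
    ?_ hs.1 (fun u _ => integral_nonneg hnonneg) ?_ ?_ ?_ ?_ ?_ ?_
  · refine setIntegral_norm_sub_rpow_pos (a := (4 : ℝ) • e) (δ := 1)
      (integrableOn_tangentGap hs (by rw [he]; exact one_pos)) one_pos ?_ ?_
    · intro y hy
      rw [mem_ball', dist_eq_norm] at hy
      have h4 : ‖(4 : ℝ) • e‖ = 4 := by rw [norm_smul, he]; norm_num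
      have h2 : ‖e + e‖ = 2 := by rw [← two_smul ℝ, norm_smul, he]; norm_num
      have h3 := norm_le_norm_sub_add ((4 : ℝ) • e) y
      have h5 := norm_sub_norm_le y (e + e)
      rw [norm_sub_rev] at h5
      constructor <;> linarith
    · rw [mem_ball', dist_eq_norm, show (4 : ℝ) • e - e = (3 : ℝ) • e by module, norm_smul, he]
      norm_num
  · exact fun a ha b _ hab => setIntegral_mono_set (hcompl a ha) (ae_of_all _ hnonneg)
      (LE.le.eventuallyLE (compl_subset_compl.2 (ball_subset_ball hab)))
  · intro t (ht : 1 < t)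
    obtain ⟨u, hu, hut⟩ := exists_between ht
    exact (continuousAt_setIntegral_compl_ball_of_integrableOn (hcompl u hu) (by linarith)
      hut).continuousWithinAt
  · exact tendsto_setIntegral_compl_ball_atTop (hcompl 2 one_lt_two)
  · exact fun t ht => setIntegral_norm_sub_rpow_pos (hball t ht.2) ht.1 subset_rfl fun h => by
      rw [mem_ball_zero_iff, he] at h
      exact h.not_gt ht.2
  · exact fun a _ b hb hab => setIntegral_mono_set (hball b hb.2) (ae_of_all _ hnonneg)
      (LE.le.eventuallyLE (ball_subset_ball hab))
  · intro t ht
    obtain ⟨u, htu, hu⟩ := exists_between ht.2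
    exact (continuousAt_setIntegral_ball_of_integrableOn (hball u hu) ht.1.ne'
      htu).continuousWithinAt

theorem annulus_shrinker_exists_unique (n : ℕ) (hn : 1 ≤ n) (s R : ℝ)
    (hs : s ∈ Set.Ioo (0 : ℝ) 1) (hR : 0 < R) :
    ∃! r : ℝ, r ∈ Set.Ioo 0 R ∧
      ∀ xr xR : EuclideanSpace ℝ (Fin n), ‖xr‖ = r → ‖xR‖ = R →
        ∃ Hr HR : ℝ,
          HasFracMeanCurvAt n s (Metric.ball 0 R \ Metric.ball 0 r) xr Hr ∧
          HasFracMeanCurvAt n s (Metric.ball 0 R \ Metric.ball 0 r) xR HR ∧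
          R * Hr + r * HR = 0 := by
  obtain ⟨e, he⟩ : ∃ e : EuclideanSpace ℝ (Fin n), ‖e‖ = 1 :=
    ⟨EuclideanSpace.single ⟨0, hn⟩ 1, by simp⟩
  obtain ⟨t, ⟨ht, hzero⟩, huniq⟩ := existsUnique_annulus_balance hs he
  refine ⟨R * t, ⟨⟨mul_pos hR ht.1, mul_lt_of_lt_one_right hR ht.2⟩, fun xr xR hxr hxR => ?_⟩, ?_⟩
  · have hr : 0 < R * t := mul_pos hR ht.1
    have hrR : R * t < R := mul_lt_of_lt_one_right hR ht.2
    refine ⟨_, _, hasFracMeanCurvAt_annulus_inner hs hr hrR he hxr,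
      hasFracMeanCurvAt_annulus_outer hs hR hrR he hxR, ?_⟩
    rw [annulus_balance_eq hr hR, ← inv_div (R * t) R, mul_div_cancel_left₀ t hR.ne', hzero,
      mul_zero]
  · rintro r ⟨⟨hr, hrR⟩, h⟩
    have hnorm : ∀ ρ : ℝ, 0 < ρ → ‖ρ • e‖ = ρ := fun ρ hρ => by
      rw [norm_smul, he, mul_one, Real.norm_of_nonneg hρ.le]
    obtain ⟨Hr, HR, h1, h2, h3⟩ := h (r • e) (R • e) (hnorm r hr) (hnorm R hR)
    rw [tendsto_nhds_unique h1 (hasFracMeanCurvAt_annulus_inner hs hr hrR he (hnorm r hr)),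
      tendsto_nhds_unique h2 (hasFracMeanCurvAt_annulus_outer hs hR hrR he (hnorm R hR)),
      annulus_balance_eq hr hR, ← inv_div r R] at h3
    have hpos : 0 < R * r ^ (-s) := mul_pos hR (Real.rpow_pos_of_pos hr _)
    rw [← huniq (r / R) ⟨⟨div_pos hr hR, (div_lt_one hR).2 hrR⟩,
      (mul_eq_zero.1 h3).resolve_left hpos.ne'⟩, mul_div_cancel₀ r hR.ne']
end

section
/- Let n ≥ 1 and s ∈ (0,1). For r ∈ (0,1) set A_r = B_1 \ B_r and f_s(r) = H_s(x_r, A_r) + r·H_s(x_1, A_r), where x_r ∈ ∂B_r and x_1 ∈ ∂B_1. Then both principal values exist for every r ∈ (0,1), and the function f_s is strictly increasing on (0,1). -/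
open MeasureTheory Filter Metric Set

section RieszKernel

open Module

variable {E : Type*} [NormedAddCommGroup E]

lemma measurable_norm_rpow [MeasurableSpace E] [BorelSpace E] (p : ℝ) :
    Measurable fun z : E => ‖z‖ ^ p := by fun_prop

variable [InnerProductSpace ℝ E]

/-- Geometry of the region outside two tangent balls: translating `z` by `t ≤ ‖z‖` along the axis
`e` keeps the norm comparable and the height close to `t`. -/
lemma norm_add_smul_bounds {e z : E} (he : ‖e‖ = 1) {r t : ℝ} (hr : 0 < r)
    (hz : 2 * r * |inner ℝ e z| ≤ ‖z‖ ^ 2) (hzr : ‖z‖ < r / 2) (ht0 : 0 < t) (htz : t < ‖z‖) :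
    0 < ‖z + t • e‖ ∧ ‖z + t • e‖ < r ∧ ‖z + t • e‖ / 2 ≤ ‖z‖ ∧
      |t - inner ℝ e (z + t • e)| ≤ 2 * ‖z + t • e‖ ^ 2 / r := by
  have hz0 : 0 < ‖z‖ := ht0.trans htz
  have hle : ‖z + t • e‖ ≤ ‖z‖ + t := by
    refine (norm_add_le _ _).trans ?_
    rw [norm_smul, he, Real.norm_of_nonneg ht0.le, mul_one]
  have hsq : ‖z + t • e‖ ^ 2 = ‖z‖ ^ 2 + 2 * t * inner ℝ e z + t ^ 2 := by
    rw [norm_add_sq_real, inner_smul_right, norm_smul, he, Real.norm_of_nonneg ht0.le,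
      real_inner_comm]
    ring
  have habs := neg_abs_le (inner ℝ e z)
  have hlow : ‖z‖ ^ 2 / 2 ≤ ‖z + t • e‖ ^ 2 := by
    have h1 : 2 * t * |inner ℝ e z| ≤ ‖z‖ ^ 2 / 2 := by
      have : 2 * t ≤ r := by linarith
      nlinarith [abs_nonneg (inner ℝ e z), mul_le_mul_of_nonneg_right this
        (abs_nonneg (inner ℝ e z))]
    nlinarith [mul_le_mul_of_nonneg_left habs ht0.le, sq_nonneg t]
  have hin : t - inner ℝ e (z + t • e) = -inner ℝ e z := by
    rw [inner_add_right, inner_smul_right, real_inner_self_eq_norm_sq, he]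
    ring
  refine ⟨?_, by linarith, by linarith, ?_⟩
  · by_contra h
    have : ‖z + t • e‖ = 0 := le_antisymm (not_lt.1 h) (norm_nonneg _)
    rw [this] at hlow
    nlinarith
  · rw [hin, abs_neg, le_div_iff₀ hr]
    nlinarith

lemma measurableSet_compl_tangent_balls [MeasurableSpace E] [BorelSpace E] (e : E) (r : ℝ) :
    MeasurableSet {z : E | 2 * r * |inner ℝ e z| ≤ ‖z‖ ^ 2} :=
  (isClosed_le (by fun_prop) (by fun_prop)).measurableSet

/-- The two opposite points `r • e ± z` contribute to the curvature of the ball at `r • e` only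
when neither of them lies in the ball. -/
lemma ball_sign_add_ball_sign {e : E} (he : ‖e‖ = 1) {r : ℝ} (hr : 0 < r) (z : E) :
    (1 - 2 * (ball (0 : E) r).indicator (fun _ => (1 : ℝ)) (r • e - z)) +
      (1 - 2 * (ball (0 : E) r).indicator (fun _ => (1 : ℝ)) (r • e + z)) =
      2 * {z : E | 2 * r * |inner ℝ e z| ≤ ‖z‖ ^ 2}.indicator (fun _ => (1 : ℝ)) z := by
  have hn : ‖r • e‖ = r := by rw [norm_smul, he, Real.norm_of_nonneg hr.le, mul_one]
  have h1 : r • e - z ∈ ball (0 : E) r ↔ ‖z‖ ^ 2 < 2 * r * inner ℝ e z := by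
    rw [mem_ball_zero_iff, ← sq_lt_sq₀ (norm_nonneg _) hr.le, norm_sub_sq_real, hn,
      real_inner_smul_left]
    constructor <;> intro h <;> linarith
  have h2 : r • e + z ∈ ball (0 : E) r ↔ ‖z‖ ^ 2 < -(2 * r * inner ℝ e z) := by
    rw [mem_ball_zero_iff, ← sq_lt_sq₀ (norm_nonneg _) hr.le, norm_add_sq_real, hn,
      real_inner_smul_left]
    constructor <;> intro h <;> linarith
  have h3 : z ∈ {z : E | 2 * r * |inner ℝ e z| ≤ ‖z‖ ^ 2} ↔
      |2 * r * inner ℝ e z| ≤ ‖z‖ ^ 2 := by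
    rw [mem_ofPred_eq, abs_mul, abs_of_pos (by positivity : 0 < 2 * r)]
  have h0 := sq_nonneg ‖z‖
  classical
  simp only [indicator_apply, h1, h2, h3, abs_le]
  generalize 2 * r * inner ℝ e z = a
  generalize ‖z‖ ^ 2 = b at h0 ⊢
  split_ifs <;> grind

variable [FiniteDimensional ℝ E] [MeasurableSpace E] [BorelSpace E]

/-- The integral of `‖z‖ ^ (-p)` over the complement of the two balls of radius `r` tangent to each
other at the origin, with axis `e`. It is the fractional mean curvature of a ball of radius `r`. -/
noncomputable def tangentBallsIntegral (p r : ℝ) (e : E) : ℝ :=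
  ∫ z in {z : E | 2 * r * |inner ℝ e z| ≤ ‖z‖ ^ 2}, ‖z‖ ^ (-p)

lemma tangentBallsIntegral_nonneg (p r : ℝ) (e : E) : 0 ≤ tangentBallsIntegral p r e :=
  integral_nonneg fun _ => by positivity

variable [Nontrivial E]

/-- The kernel `‖z‖ ^ (-p)` with `p > dim E` is integrable away from the origin. -/
lemma integrableOn_norm_rpow_compl_ball {p δ : ℝ} (hp : (finrank ℝ E : ℝ) < p) (hδ : 0 < δ) :
    IntegrableOn (fun z : E => ‖z‖ ^ (-p)) {z | δ ≤ ‖z‖} := by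
  have hm : MeasurableSet {z : E | δ ≤ ‖z‖} := measurableSet_le measurable_const measurable_norm
  rw [← integrable_indicator_iff hm]
  have key := integrable_fun_norm_addHaar (E := E) (volume : Measure E)
    (f := indicator (Ici δ) fun y : ℝ => y ^ (-p))
  refine key.2 ?_
  have hd : 0 < finrank ℝ E := finrank_pos
  have h1 : IntegrableOn (fun y : ℝ => y ^ ((finrank ℝ E : ℝ) - 1 - p)) (Ici δ) := by
    rw [integrableOn_Ici_iff_integrableOn_Ioi]
    exact integrableOn_Ioi_rpow_of_lt (by linarith) hδ
  have h2 : IntegrableOn (indicator (Ici δ) fun y : ℝ => y ^ ((finrank ℝ E : ℝ) - 1 - p))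
      (Ioi 0) := ((integrable_indicator_iff measurableSet_Ici).2 h1).integrableOn
  refine h2.congr_fun (fun y hy => ?_) measurableSet_Ioi
  by_cases h : y ∈ Ici δ
  · simp only [h, indicator_of_mem, smul_eq_mul]
    rw [← Real.rpow_natCast, ← Real.rpow_add hy, Nat.cast_sub hd]
    congr 1
    push_cast
    ring
  · simp [h]

/-- The kernel `‖z‖ ^ (-q)` with `q < dim E` is integrable near the origin. -/
lemma integrableOn_norm_rpow_ball {q R : ℝ} (hq : q < finrank ℝ E) (hR : 0 < R) :
    IntegrableOn (fun z : E => ‖z‖ ^ (-q)) {z | ‖z‖ < R} := by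
  have hm : MeasurableSet {z : E | ‖z‖ < R} := measurableSet_lt measurable_norm measurable_const
  rw [← integrable_indicator_iff hm]
  have key := integrable_fun_norm_addHaar (E := E) (volume : Measure E)
    (f := indicator (Iio R) fun y : ℝ => y ^ (-q))
  refine key.2 ?_
  have hd : 0 < finrank ℝ E := finrank_pos
  have h1 : IntegrableOn (fun y : ℝ => y ^ ((finrank ℝ E : ℝ) - 1 - q)) (Ioo 0 R) :=
    (intervalIntegral.integrableOn_Ioo_rpow_iff hR).2 (by linarith)
  have h2 : IntegrableOn (indicator (Ioo 0 R) fun y : ℝ => y ^ ((finrank ℝ E : ℝ) - 1 - q))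
      (Ioi 0) := ((integrable_indicator_iff measurableSet_Ioo).2 h1).integrableOn
  refine h2.congr_fun (fun y hy => ?_) measurableSet_Ioi
  have hy' : 0 < y := hy
  by_cases h : y < R
  · simp only [mem_Ioo, mem_Iio, hy', h, and_self, indicator_of_mem, smul_eq_mul]
    rw [← Real.rpow_natCast, ← Real.rpow_add hy, Nat.cast_sub hd]
    congr 1
    push_cast
    ring
  · simp [h]

/-- The complement of two balls of radius `r` tangent to each other at the origin is thin enough
near the origin for the kernel `‖z‖ ^ (-p)`, `p < dim E + 1`, to be integrable on it. -/
lemma integrableOn_norm_rpow_compl_tangent_balls_near {e : E} (he : ‖e‖ = 1) {r p : ℝ}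
    (hr : 0 < r) (hp0 : 0 < p) (hp : p < finrank ℝ E + 1) :
    IntegrableOn (fun z : E => ‖z‖ ^ (-p))
      ({z | 2 * r * |inner ℝ e z| ≤ ‖z‖ ^ 2} ∩ {z | ‖z‖ < r / 2}) := by
  set S : Set E := {z | 2 * r * |inner ℝ e z| ≤ ‖z‖ ^ 2} ∩ {z | ‖z‖ < r / 2} with hS
  have hSm : MeasurableSet S := (measurableSet_compl_tangent_balls e r).inter
    (measurableSet_lt measurable_norm measurable_const)
  let A : Set (E × ℝ) := {w | w.1 ∈ S ∧ 0 < w.2 ∧ w.2 < ‖w.1‖}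
  have hA : MeasurableSet A := (measurable_fst hSm).inter
    ((measurableSet_lt measurable_const measurable_snd).inter
      (measurableSet_lt measurable_snd (measurable_norm.comp measurable_fst)))
  let F : E × ℝ → ENNReal := A.indicator fun w => ENNReal.ofReal (‖w.1‖ ^ (-p - 1))
  have hF : Measurable F := Measurable.indicator (by fun_prop) hA
  let B : Set (E × ℝ) := {w | ‖w.1‖ < r ∧ |w.2 - inner ℝ e w.1| ≤ 2 * ‖w.1‖ ^ 2 / r}
  let G : E × ℝ → ENNReal := B.indicator fun w => ENNReal.ofReal ((‖w.1‖ / 2) ^ (-p - 1))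
  have hFG : ∀ u t, F (u - t • e, t) ≤ G (u, t) := by
    intro u t
    by_cases h : (u - t • e, t) ∈ A
    · obtain ⟨⟨h1, h2⟩, h3, h4⟩ := h
      obtain ⟨g1, g2, g3, g4⟩ := norm_add_smul_bounds he hr h1 h2 h3 h4
      rw [sub_add_cancel] at g1 g2 g3 g4
      have hB : (u, t) ∈ B := ⟨g2, g4⟩
      simp only [F, G, indicator_of_mem (show (u - t • e, t) ∈ A from ⟨⟨h1, h2⟩, h3, h4⟩),
        indicator_of_mem hB]
      exact ENNReal.ofReal_le_ofReal
        (Real.rpow_le_rpow_of_nonpos (by positivity) g3 (by linarith))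
    · simp [F, indicator_of_notMem h]
  have hGint : ∀ u, ∫⁻ t, G (u, t) ≤ {z : E | ‖z‖ < r}.indicator
      (fun z => ENNReal.ofReal ((2 : ℝ) ^ (p + 1) * (4 / r)) *
        ENNReal.ofReal (‖z‖ ^ (-(p - 1)))) u := by
    intro u
    by_cases hu : ‖u‖ < r
    · have h1 : ∀ t, G (u, t) = (Icc (inner ℝ e u - 2 * ‖u‖ ^ 2 / r)
          (inner ℝ e u + 2 * ‖u‖ ^ 2 / r)).indicator
          (fun _ => ENNReal.ofReal ((‖u‖ / 2) ^ (-p - 1))) t := by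
        intro t
        have : (u, t) ∈ B ↔ t ∈ Icc (inner ℝ e u - 2 * ‖u‖ ^ 2 / r)
            (inner ℝ e u + 2 * ‖u‖ ^ 2 / r) := by
          simp only [B, mem_ofPred_eq, hu, true_and, abs_le, mem_Icc]
          constructor <;> rintro ⟨_, _⟩ <;> constructor <;> linarith
        by_cases ht : (u, t) ∈ B
        · simp only [G]
          rw [indicator_of_mem ht, indicator_of_mem (this.1 ht)]
        · simp only [G]
          rw [indicator_of_notMem ht, indicator_of_notMem (fun h => ht (this.2 h))]
      simp_rw [h1]
      rw [lintegral_indicator_const measurableSet_Icc, Real.volume_Icc,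
        indicator_of_mem (show u ∈ {z : E | ‖z‖ < r} from hu),
        ← ENNReal.ofReal_mul (by positivity), ← ENNReal.ofReal_mul (by positivity)]
      apply ENNReal.ofReal_le_ofReal
      rcases (norm_nonneg u).eq_or_lt with h0 | h0
      · rw [← h0]
        simp only [zero_div, ne_eq, OfNat.ofNat_ne_zero, not_false_eq_true, zero_pow, mul_zero,
          sub_zero, add_zero, sub_self]
        positivity
      · have e1 : (‖u‖ / 2) ^ (-p - 1) = (2 : ℝ) ^ (p + 1) * ‖u‖ ^ (-p - 1) := by
          rw [Real.div_rpow h0.le zero_le_two, show p + 1 = -(-p - 1) by ring,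
            Real.rpow_neg zero_le_two]
          field_simp
        have e2 : ‖u‖ ^ (-(p - 1)) = ‖u‖ ^ (-p - 1) * ‖u‖ ^ 2 := by
          rw [← Real.rpow_natCast ‖u‖ 2, ← Real.rpow_add h0]
          congr 1
          push_cast
          ring
        rw [e1, e2]
        apply le_of_eq
        ring
    · have : ∀ t, G (u, t) = 0 := fun t => indicator_of_notMem (fun h => hu h.1) _
      simp [this]
  have hstart : ∀ z, ∫⁻ t, F (z, t) = S.indicator (fun z => ENNReal.ofReal (‖z‖ ^ (-p))) z := by
    intro z
    by_cases hz : z ∈ S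
    · have h1 : ∀ t, F (z, t) = (Ioo 0 ‖z‖).indicator
          (fun _ => ENNReal.ofReal (‖z‖ ^ (-p - 1))) t := by
        intro t
        by_cases ht : t ∈ Ioo 0 ‖z‖
        · rw [indicator_of_mem ht]
          exact indicator_of_mem (show (z, t) ∈ A from ⟨hz, ht⟩) _
        · rw [indicator_of_notMem ht]
          exact indicator_of_notMem (fun h => ht h.2) _
      simp_rw [h1]
      rw [lintegral_indicator_const measurableSet_Ioo, Real.volume_Ioo, indicator_of_mem hz,
        sub_zero, ← ENNReal.ofReal_mul (by positivity)]
      congr 1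
      rcases (norm_nonneg z).eq_or_lt with h0 | h0
      · rw [← h0, mul_zero, Real.zero_rpow (by linarith)]
      · nth_rewrite 2 [← Real.rpow_one ‖z‖]
        rw [← Real.rpow_add h0]
        congr 1
        ring
    · have : ∀ t, F (z, t) = 0 := fun t => indicator_of_notMem (fun h => hz h.1) _
      simp [this, indicator_of_notMem hz]
  have hfin : ∫⁻ z, S.indicator (fun z => ENNReal.ofReal (‖z‖ ^ (-p))) z < ⊤ := by
    calc ∫⁻ z, S.indicator (fun z => ENNReal.ofReal (‖z‖ ^ (-p))) z
        = ∫⁻ z, ∫⁻ t, F (z, t) := by simp_rw [hstart]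
      _ = ∫⁻ t, ∫⁻ z, F (z, t) := lintegral_lintegral_swap (f := fun z t => F (z, t))
          hF.aemeasurable
      _ = ∫⁻ t, ∫⁻ u, F (u - t • e, t) := by
          congr 1
          ext t
          exact (lintegral_sub_right_eq_self (fun z => F (z, t)) (t • e)).symm
      _ = ∫⁻ u, ∫⁻ t, F (u - t • e, t) := by
          refine lintegral_lintegral_swap (f := fun t u => F (u - t • e, t)) ?_
          refine (hF.comp ?_).aemeasurable
          fun_prop
      _ ≤ ∫⁻ u, ∫⁻ t, G (u, t) := lintegral_mono fun u => lintegral_mono fun t => hFG u t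
      _ ≤ _ := lintegral_mono hGint
      _ = ENNReal.ofReal ((2 : ℝ) ^ (p + 1) * (4 / r)) *
            ∫⁻ z in {z : E | ‖z‖ < r}, ENNReal.ofReal (‖z‖ ^ (-(p - 1))) := by
          rw [lintegral_indicator (measurableSet_lt measurable_norm measurable_const),
            lintegral_const_mul _ (by fun_prop)]
      _ < ⊤ := by
          refine ENNReal.mul_lt_top ENNReal.ofReal_lt_top ?_
          have := (integrableOn_norm_rpow_ball (E := E) (q := p - 1) (by linarith) hr)
          exact this.lintegral_lt_top
  refine ⟨(measurable_norm_rpow _).aestronglyMeasurable, ?_⟩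
  rw [hasFiniteIntegral_iff_ofReal (ae_of_all _ fun z => by positivity)]
  rwa [lintegral_indicator hSm] at hfin

lemma integrableOn_norm_rpow_compl_tangent_balls {e : E} (he : ‖e‖ = 1) {r p : ℝ}
    (hr : 0 < r) (hp₁ : (finrank ℝ E : ℝ) < p) (hp₂ : p < finrank ℝ E + 1) :
    IntegrableOn (fun z : E => ‖z‖ ^ (-p)) {z | 2 * r * |inner ℝ e z| ≤ ‖z‖ ^ 2} := by
  have hp0 : 0 < p := (Nat.cast_nonneg _).trans_lt hp₁
  refine ((integrableOn_norm_rpow_compl_tangent_balls_near he hr hp0 hp₂).union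
    (integrableOn_norm_rpow_compl_ball (E := E) hp₁ (half_pos hr))).mono_set fun z hz => ?_
  rcases lt_or_ge ‖z‖ (r / 2) with h | h
  · exact Or.inl ⟨hz, h⟩
  · exact Or.inr h

lemma tendsto_setIntegral_dist_gt {f : E → ℝ} (hf : Integrable f) (x : E) :
    Tendsto (fun ε : ℝ => ∫ y in {y : E | ε < dist y x}, f y) (nhdsWithin 0 (Ioi 0))
      (nhds (∫ y, f y)) := by
  have hm : ∀ ε : ℝ, MeasurableSet {y : E | ε < dist y x} := fun ε =>
    measurableSet_lt measurable_const (measurable_id.dist measurable_const)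
  simp_rw [← integral_indicator (hm _)]
  refine tendsto_integral_filter_of_dominated_convergence (fun y => ‖f y‖)
    (Eventually.of_forall fun ε => hf.aestronglyMeasurable.indicator (hm ε))
    (Eventually.of_forall fun ε => ae_of_all _ fun y => norm_indicator_le_norm_self _ _) hf.norm ?_
  filter_upwards [compl_mem_ae_iff.2
    (measure_singleton (μ := (volume : Measure E)) x)] with y hy
  have hd : 0 < dist y x := dist_pos.2 hy
  refine tendsto_const_nhds.congr' ?_
  filter_upwards [nhdsWithin_le_nhds (Iio_mem_nhds hd)] with ε hε
  exact (indicator_of_mem (show y ∈ {y : E | ε < dist y x} from hε) f).symm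

lemma integrableOn_norm_sub_rpow_s2 {p δ : ℝ} (hp : (finrank ℝ E : ℝ) < p) (hδ : 0 < δ) {x : E}
    {D : Set E} (hD : MeasurableSet D) (hdist : ∀ y ∈ D, δ ≤ ‖x - y‖) :
    IntegrableOn (fun y : E => ‖x - y‖ ^ (-p)) D := by
  have hm : MeasurableSet {z : E | δ ≤ ‖z‖} := measurableSet_le measurable_const measurable_norm
  have h1 := ((integrable_indicator_iff hm).2
    (integrableOn_norm_rpow_compl_ball (E := E) hp hδ)).comp_sub_left x
  refine h1.integrableOn.congr_fun (fun y hy => ?_) hD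
  exact indicator_of_mem (show x - y ∈ {z : E | δ ≤ ‖z‖} from hdist y hy) _

lemma integrableOn_ball_sign_mul {p ε : ℝ} (hp : (finrank ℝ E : ℝ) < p) (hε : 0 < ε)
    (r : ℝ) (x : E) :
    IntegrableOn (fun y : E => (1 - 2 * (ball (0 : E) r).indicator (fun _ => (1 : ℝ)) y) *
      ‖x - y‖ ^ (-p)) {y | ε < dist y x} := by
  have hm : MeasurableSet {y : E | ε < dist y x} :=
    measurableSet_lt measurable_const (measurable_id.dist measurable_const)
  have h1 := integrableOn_norm_sub_rpow_s2 (E := E) hp hε hm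
    (fun y (hy : ε < dist y x) => by rw [dist_eq_norm, norm_sub_rev] at hy; exact hy.le)
  have hmeas : Measurable fun y : E =>
      1 - 2 * (ball (0 : E) r).indicator (fun _ => (1 : ℝ)) y :=
    measurable_const.sub (measurable_const.mul (measurable_const.indicator measurableSet_ball))
  refine Integrable.bdd_mul (c := 1) h1 hmeas.aestronglyMeasurable (ae_of_all _ fun y => ?_)
  by_cases hy : y ∈ ball (0 : E) r
  · rw [indicator_of_mem hy]
    norm_num
  · rw [indicator_of_notMem hy]
    norm_num

lemma setIntegral_ball_sign_mul {e : E} (he : ‖e‖ = 1) {r p ε : ℝ} (hr : 0 < r)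
    (hp : (finrank ℝ E : ℝ) < p) (hε : 0 < ε) :
    ∫ y in {y : E | ε < dist y (r • e)},
        (1 - 2 * (ball (0 : E) r).indicator (fun _ => (1 : ℝ)) y) * ‖r • e - y‖ ^ (-p) =
      ∫ z in {z : E | ε < dist z 0},
        {z : E | 2 * r * |inner ℝ e z| ≤ ‖z‖ ^ 2}.indicator (fun z => ‖z‖ ^ (-p)) z := by
  have hm : ∀ x : E, MeasurableSet {y : E | ε < dist y x} := fun x =>
    measurableSet_lt measurable_const (measurable_id.dist measurable_const)
  have hint := (integrable_indicator_iff (hm (r • e))).2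
    (integrableOn_ball_sign_mul (E := E) hp hε r (r • e))
  rw [← integral_indicator (hm _), ← integral_indicator (hm _)]
  set h := {y : E | ε < dist y (r • e)}.indicator fun y =>
    (1 - 2 * (ball (0 : E) r).indicator (fun _ => (1 : ℝ)) y) * ‖r • e - y‖ ^ (-p) with hh
  have e1 := integral_sub_left_eq_self h (volume : Measure E) (r • e)
  have e2 := integral_add_left_eq_self (μ := (volume : Measure E)) h (r • e)
  have e3 : ∫ z, (h (r • e - z) + h (r • e + z)) = ∫ z, 2 * {z : E | ε < dist z 0}.indicator
      ({z : E | 2 * r * |inner ℝ e z| ≤ ‖z‖ ^ 2}.indicator fun z => ‖z‖ ^ (-p)) z := by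
    congr 1
    ext z
    have hb := ball_sign_add_ball_sign he hr z
    by_cases hz : ε < ‖z‖
    · have m1 : r • e - z ∈ {y : E | ε < dist y (r • e)} := by
        simpa [dist_eq_norm] using hz
      have m2 : r • e + z ∈ {y : E | ε < dist y (r • e)} := by
        simpa [dist_eq_norm] using hz
      have m3 : z ∈ {z : E | ε < dist z 0} := by simpa using hz
      rw [hh, indicator_of_mem m1, indicator_of_mem m2, indicator_of_mem m3, sub_sub_cancel,
        sub_add_cancel_left, norm_neg, ← add_mul, hb, mul_assoc]
      congr 1
      simp [indicator_apply]
    · have m1 : r • e - z ∉ {y : E | ε < dist y (r • e)} := by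
        simpa [dist_eq_norm] using hz
      have m2 : r • e + z ∉ {y : E | ε < dist y (r • e)} := by
        simpa [dist_eq_norm] using hz
      have m3 : z ∉ {z : E | ε < dist z 0} := by simpa using hz
      rw [hh, indicator_of_notMem m1, indicator_of_notMem m2, indicator_of_notMem m3]
      norm_num
  rw [integral_add (hint.comp_sub_left _) (hint.comp_add_left _), e1, e2,
    integral_const_mul] at e3
  linarith

/-- The principal value defining the fractional mean curvature of a ball. -/
lemma tendsto_ball_sign_integral {e : E} (he : ‖e‖ = 1) {r p : ℝ} (hr : 0 < r)
    (hp₁ : (finrank ℝ E : ℝ) < p) (hp₂ : p < finrank ℝ E + 1) :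
    Tendsto (fun ε : ℝ => ∫ y in {y : E | ε < dist y (r • e)},
        (1 - 2 * (ball (0 : E) r).indicator (fun _ => (1 : ℝ)) y) * ‖r • e - y‖ ^ (-p))
      (nhdsWithin 0 (Ioi 0)) (nhds (tangentBallsIntegral p r e)) := by
  have hS := measurableSet_compl_tangent_balls e r
  have h := tendsto_setIntegral_dist_gt ((integrable_indicator_iff hS).2
    (integrableOn_norm_rpow_compl_tangent_balls he hr hp₁ hp₂)) 0
  rw [integral_indicator hS] at h
  refine h.congr' ?_
  filter_upwards [self_mem_nhdsWithin] with ε hε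
  exact (setIntegral_ball_sign_mul he hr hp₁ hε).symm

/-- The principal value for a weight which is, up to sign, that of a ball, modified on a set `D` at
positive distance from the point. -/
lemma tendsto_ball_sign_add_integral {e : E} (he : ‖e‖ = 1) {r p δ : ℝ} (hr : 0 < r)
    (hp₁ : (finrank ℝ E : ℝ) < p) (hp₂ : p < finrank ℝ E + 1) (σ : ℝ) {D : Set E}
    (hD : MeasurableSet D) (hδ : 0 < δ) (hdist : ∀ y ∈ D, δ ≤ ‖r • e - y‖) {w : E → ℝ}
    (hw : ∀ y, w y = σ * (1 - 2 * (ball (0 : E) r).indicator (fun _ => (1 : ℝ)) y) +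
      2 * D.indicator (fun _ => (1 : ℝ)) y) :
    Tendsto (fun ε : ℝ => ∫ y in {y : E | ε < dist y (r • e)}, w y * ‖r • e - y‖ ^ (-p))
      (nhdsWithin 0 (Ioi 0))
      (nhds (σ * tangentBallsIntegral p r e + 2 * ∫ y in D, ‖r • e - y‖ ^ (-p))) := by
  have hint := (integrable_indicator_iff hD).2 (integrableOn_norm_sub_rpow_s2 (E := E) hp₁ hδ hD hdist)
  have h := ((tendsto_ball_sign_integral he hr hp₁ hp₂).const_mul σ).add
    ((tendsto_setIntegral_dist_gt hint (r • e)).const_mul 2)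
  rw [integral_indicator hD] at h
  refine h.congr' ?_
  filter_upwards [self_mem_nhdsWithin] with ε hε
  rw [← integral_const_mul, ← integral_const_mul, ← integral_add
    ((integrableOn_ball_sign_mul (E := E) hp₁ hε r (r • e)).const_mul σ)
    (hint.integrableOn.const_mul 2)]
  congr 1
  ext y
  rw [hw, add_mul, mul_assoc σ]
  congr 1
  by_cases hy : y ∈ D <;> simp [hy]

/-- The fractional mean curvature of a ball decreases with the radius. -/
lemma tangentBallsIntegral_anti {e : E} (he : ‖e‖ = 1) {r₁ r₂ p : ℝ} (hr₁ : 0 < r₁)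
    (hr : r₁ ≤ r₂) (hp₁ : (finrank ℝ E : ℝ) < p) (hp₂ : p < finrank ℝ E + 1) :
    tangentBallsIntegral p r₂ e ≤ tangentBallsIntegral p r₁ e := by
  refine setIntegral_mono_set (integrableOn_norm_rpow_compl_tangent_balls he hr₁ hp₁ hp₂)
    (ae_of_all _ fun z => by positivity) (LE.le.eventuallyLE fun z hz => ?_)
  have hz' : 2 * r₂ * |inner ℝ e z| ≤ ‖z‖ ^ 2 := hz
  refine le_trans ?_ hz'
  gcongr

/-- The interaction of the point `r • e` with the complement of the unit ball increases with
`r ∈ (0, 1)`. -/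
lemma integral_compl_ball_mono {e : E} (he : ‖e‖ = 1) {r₁ r₂ p : ℝ} (hr₁ : 0 < r₁) (hr : r₁ < r₂)
    (hr₂ : r₂ < 1) (hp : (finrank ℝ E : ℝ) < p) :
    ∫ y in (ball (0 : E) 1)ᶜ, ‖r₁ • e - y‖ ^ (-p) ≤
      ∫ y in (ball (0 : E) 1)ᶜ, ‖r₂ • e - y‖ ^ (-p) := by
  have hDm : MeasurableSet (ball (0 : E) 1)ᶜ := measurableSet_ball.compl
  have hnorm : ∀ r : ℝ, 0 < r → ‖r • e‖ = r := fun r h => by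
    rw [norm_smul, he, Real.norm_of_nonneg h.le, mul_one]
  let F : ℝ → E → ℝ := fun r => (ball (0 : E) 1)ᶜ.indicator fun y => ‖r • e - y‖ ^ (-p)
  have hFapp : ∀ r u, F r u = if 1 ≤ ‖u‖ then ‖r • e - u‖ ^ (-p) else 0 := fun r u => by
    classical
    simp [F, indicator_apply]
  have hF : ∀ r, 0 < r → r < 1 → Integrable (F r) := fun r h0 h1 => by
    refine (integrable_indicator_iff hDm).2 (integrableOn_norm_sub_rpow_s2 (E := E) hp
      (sub_pos.2 h1) hDm fun y hy => ?_)
    have hy' : 1 ≤ ‖y‖ := by simpa using hy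
    have := norm_sub_norm_le y (r • e)
    rw [hnorm r h0, norm_sub_rev] at this
    linarith
  have hF₁ := hF r₁ hr₁ (hr.trans hr₂)
  have hF₂ := hF r₂ (hr₁.trans hr) hr₂
  rw [← integral_indicator hDm, ← integral_indicator hDm]
  change ∫ y, F r₁ y ≤ ∫ y, F r₂ y
  have a₁ := integral_sub_left_eq_self (F r₁) (volume : Measure E) (r₁ • e)
  have a₂ := integral_sub_left_eq_self (F r₂) (volume : Measure E) (r₂ • e)
  have b₁ := integral_sub_right_eq_self (μ := (volume : Measure E)) (F r₁) (r₂ • e)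
  have b₂ := integral_sub_right_eq_self (μ := (volume : Measure E)) (F r₂) (r₁ • e)
  have key : ∫ z, (F r₁ (r₁ • e - z) + F r₁ (z - r₂ • e)) ≤
      ∫ z, (F r₂ (r₂ • e - z) + F r₂ (z - r₁ • e)) := by
    refine integral_mono ((hF₁.comp_sub_left _).add (hF₁.comp_sub_right _))
      ((hF₂.comp_sub_left _).add (hF₂.comp_sub_right _)) fun z => ?_
    have hs : ∀ r : ℝ, 0 < r → ‖r • e - z‖ ^ 2 = r ^ 2 - 2 * r * inner ℝ e z + ‖z‖ ^ 2 :=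
      fun r h => by rw [norm_sub_sq_real, hnorm r h, real_inner_smul_left, mul_assoc]
    have hT : ‖(r₁ + r₂) • e - z‖ ^ 2 =
        (r₁ + r₂) ^ 2 - 2 * (r₁ + r₂) * inner ℝ e z + ‖z‖ ^ 2 := hs _ (by linarith)
    have d₁ := hs r₁ hr₁
    have d₂ := hs r₂ (hr₁.trans hr)
    have hk : ∀ a b : ℝ, b < a → 0 < b → a ^ (-p) ≤ b ^ (-p) := fun a b hab hb =>
      Real.rpow_le_rpow_of_nonpos hb hab.le
        (by have := Nat.cast_nonneg (α := ℝ) (finrank ℝ E); linarith)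
    have c₁ : r₁ • e - (z - r₂ • e) = (r₁ + r₂) • e - z := by module
    have c₂ : r₂ • e - (z - r₁ • e) = (r₁ + r₂) • e - z := by module
    simp only [hFapp, sub_sub_cancel, c₁, c₂, norm_sub_rev z]
    by_cases h₁ : 1 ≤ ‖r₁ • e - z‖ <;> by_cases h₂ : 1 ≤ ‖r₂ • e - z‖ <;>
      simp only [h₁, h₂, if_true, if_false, add_zero, zero_add]
    · rw [add_comm]
    · have h₃ : (r₁ + r₂) • e - z ≠ 0 := fun h => by
        rw [← sub_eq_zero.1 h, ← sub_smul, norm_smul, he, Real.norm_eq_abs,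
          abs_of_neg (by linarith)] at h₁
        linarith
      refine hk _ _ (lt_of_pow_lt_pow_left₀ 2 (norm_nonneg _) ?_) (norm_pos_iff.2 h₃)
      have h₄ : ‖r₂ • e - z‖ ^ 2 < ‖r₁ • e - z‖ ^ 2 :=
        pow_lt_pow_left₀ (by linarith) (norm_nonneg _) two_ne_zero
      nlinarith
    · have h₃ : z ≠ 0 := fun h => by
        rw [h, sub_zero, hnorm r₂ (hr₁.trans hr)] at h₂
        linarith
      refine hk _ _ (lt_of_pow_lt_pow_left₀ 2 (norm_nonneg _) ?_) (norm_pos_iff.2 h₃)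
      have h₄ : ‖r₁ • e - z‖ ^ 2 < ‖r₂ • e - z‖ ^ 2 :=
        pow_lt_pow_left₀ (by linarith) (norm_nonneg _) two_ne_zero
      nlinarith
    · exact le_rfl
  rw [integral_add (hF₁.comp_sub_left _) (hF₁.comp_sub_right _),
    integral_add (hF₂.comp_sub_left _) (hF₂.comp_sub_right _), a₁, a₂, b₁, b₂] at key
  linarith

end RieszKernel

section Annulus

variable {n : ℕ}

/-- The fractional mean curvature is invariant under linear isometries preserving the set. -/
lemma HasFracMeanCurvAt.map_linearIsometryEquiv {s H : ℝ} {A : Set (EuclideanSpace ℝ (Fin n))}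
    {x : EuclideanSpace ℝ (Fin n)} (h : HasFracMeanCurvAt n s A x H)
    (L : EuclideanSpace ℝ (Fin n) ≃ₗᵢ[ℝ] EuclideanSpace ℝ (Fin n)) (hL : ∀ y, L y ∈ A ↔ y ∈ A) :
    HasFracMeanCurvAt n s A (L x) H := by
  refine h.congr fun ε => ?_
  rw [← L.measurePreserving.setIntegral_preimage_emb L.toHomeomorph.measurableEmbedding
    _ {y | ε < dist y (L x)}]
  have hset : L ⁻¹' {y | ε < dist y (L x)} = {y | ε < dist y x} := by
    ext y
    simp [L.dist_map]
  rw [hset]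
  congr 1
  ext y
  classical
  simp only [indicator_apply, mem_compl_iff, hL, ← map_sub, L.norm_map]

lemma annulus_weight_inner {r : ℝ} (hr : r < 1) (y : EuclideanSpace ℝ (Fin n)) :
    (ball (0 : EuclideanSpace ℝ (Fin n)) 1 \ ball 0 r)ᶜ.indicator (fun _ => (1 : ℝ)) y -
      (ball 0 1 \ ball 0 r).indicator (fun _ => (1 : ℝ)) y =
      -1 * (1 - 2 * (ball 0 r).indicator (fun _ => (1 : ℝ)) y) +
        2 * (ball 0 1)ᶜ.indicator (fun _ => (1 : ℝ)) y := by
  have h : y ∈ ball (0 : EuclideanSpace ℝ (Fin n)) r → y ∈ ball 0 1 := fun h =>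
    ball_subset_ball hr.le h
  classical
  simp only [indicator_apply, mem_compl_iff, Set.mem_sdiff]
  split_ifs <;> first | (exfalso; tauto) | norm_num

lemma annulus_weight_outer {r : ℝ} (hr : r < 1) (y : EuclideanSpace ℝ (Fin n)) :
    (ball (0 : EuclideanSpace ℝ (Fin n)) 1 \ ball 0 r)ᶜ.indicator (fun _ => (1 : ℝ)) y -
      (ball 0 1 \ ball 0 r).indicator (fun _ => (1 : ℝ)) y =
      1 * (1 - 2 * (ball 0 1).indicator (fun _ => (1 : ℝ)) y) +
        2 * (ball 0 r).indicator (fun _ => (1 : ℝ)) y := by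
  have h : y ∈ ball (0 : EuclideanSpace ℝ (Fin n)) r → y ∈ ball 0 1 := fun h =>
    ball_subset_ball hr.le h
  classical
  simp only [indicator_apply, mem_compl_iff, Set.mem_sdiff]
  split_ifs <;> first | (exfalso; tauto) | norm_num

end Annulus

theorem annulus_fs_strictMono (n : ℕ) (hn : 1 ≤ n) (s : ℝ)
    (hs : s ∈ Set.Ioo (0 : ℝ) 1) :
    ∃ Hin Hout : ℝ → ℝ,
      (∀ r ∈ Set.Ioo (0 : ℝ) 1,
        (∀ x : EuclideanSpace ℝ (Fin n), ‖x‖ = r →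
          HasFracMeanCurvAt n s (Metric.ball 0 1 \ Metric.ball 0 r) x (Hin r)) ∧
        (∀ x : EuclideanSpace ℝ (Fin n), ‖x‖ = 1 →
          HasFracMeanCurvAt n s (Metric.ball 0 1 \ Metric.ball 0 r) x (Hout r))) ∧
      StrictMonoOn (fun r => Hin r + r * Hout r) (Set.Ioo (0 : ℝ) 1) := by
  obtain ⟨hs0, hs1⟩ := hs
  have : Nonempty (Fin n) := ⟨⟨0, hn⟩⟩
  have hfr : (Module.finrank ℝ (EuclideanSpace ℝ (Fin n)) : ℝ) = n := by
    rw [finrank_euclideanSpace_fin]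
  have hp₁ : (Module.finrank ℝ (EuclideanSpace ℝ (Fin n)) : ℝ) < n + s := by linarith
  have hp₂ : (n : ℝ) + s < Module.finrank ℝ (EuclideanSpace ℝ (Fin n)) + 1 := by linarith
  obtain ⟨e, he⟩ := exists_norm_eq (EuclideanSpace ℝ (Fin n)) zero_le_one
  have hrot : ∀ {r ρ H : ℝ}, 0 < ρ →
      HasFracMeanCurvAt n s (ball 0 1 \ ball 0 r) (ρ • e) H →
      ∀ x : EuclideanSpace ℝ (Fin n), ‖x‖ = ρ →
        HasFracMeanCurvAt n s (ball 0 1 \ ball 0 r) x H := by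
    intro r ρ H hρ h x hx
    have hxe : ‖ρ • e‖ = ‖x‖ := by rw [norm_smul, he, Real.norm_of_nonneg hρ.le, mul_one, hx]
    rw [← Submodule.reflection_sub hxe]
    exact h.map_linearIsometryEquiv _ fun y => by simp
  have hdin : ∀ r : ℝ, 0 < r → ∀ y ∈ (ball (0 : EuclideanSpace ℝ (Fin n)) 1)ᶜ,
      1 - r ≤ ‖r • e - y‖ := fun r h0 y hy => by
    have hy' : 1 ≤ ‖y‖ := by simpa using hy
    have := norm_sub_norm_le y (r • e)
    rw [norm_smul, he, Real.norm_of_nonneg h0.le, norm_sub_rev] at this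
    linarith
  have hdout : ∀ r : ℝ, ∀ y ∈ ball (0 : EuclideanSpace ℝ (Fin n)) r,
      1 - r ≤ ‖(1 : ℝ) • e - y‖ := fun r y hy => by
    have hy' : ‖y‖ < r := by simpa using hy
    have := norm_sub_norm_le ((1 : ℝ) • e) y
    rw [norm_smul, he, norm_one] at this
    linarith
  let C : ℝ → ℝ := fun r => tangentBallsIntegral (n + s) r e
  let Φ : ℝ → ℝ := fun r =>
    ∫ y in (ball (0 : EuclideanSpace ℝ (Fin n)) 1)ᶜ, ‖r • e - y‖ ^ (-((n : ℝ) + s))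
  let Ψ : ℝ → ℝ := fun r =>
    ∫ y in ball (0 : EuclideanSpace ℝ (Fin n)) r, ‖(1 : ℝ) • e - y‖ ^ (-((n : ℝ) + s))
  have hΨint : ∀ r < 1, IntegrableOn (fun y => ‖(1 : ℝ) • e - y‖ ^ (-((n : ℝ) + s)))
      (ball (0 : EuclideanSpace ℝ (Fin n)) r) := fun r hr =>
    integrableOn_norm_sub_rpow_s2 hp₁ (sub_pos.2 hr) measurableSet_ball (hdout r)
  refine ⟨fun r => -1 * C r + 2 * Φ r, fun r => 1 * C 1 + 2 * Ψ r, fun r hr => ⟨?_, ?_⟩, ?_⟩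
  · refine hrot hr.1 ?_
    exact tendsto_ball_sign_add_integral he hr.1 hp₁ hp₂ (-1) measurableSet_ball.compl
      (sub_pos.2 hr.2) (hdin r hr.1) (annulus_weight_inner hr.2)
  · refine hrot one_pos ?_
    exact tendsto_ball_sign_add_integral he one_pos hp₁ hp₂ 1 measurableSet_ball
      (sub_pos.2 hr.2) (hdout r) (annulus_weight_outer hr.2)
  · intro r₁ hr₁ r₂ hr₂ hr
    have hC : C r₂ ≤ C r₁ := tangentBallsIntegral_anti he hr₁.1 hr.le hp₁ hp₂
    have hC1 : 0 ≤ C 1 := tangentBallsIntegral_nonneg _ _ _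
    have hΦ : Φ r₁ ≤ Φ r₂ := integral_compl_ball_mono he hr₁.1 hr hr₂.2 hp₁
    have hΨ : Ψ r₁ ≤ Ψ r₂ := setIntegral_mono_set (hΨint r₂ hr₂.2)
      (ae_of_all _ fun z => by positivity) (LE.le.eventuallyLE (ball_subset_ball hr.le))
    have hΨpos : 0 < Ψ r₂ := by
      refine (setIntegral_pos_iff_support_of_nonneg_ae (ae_of_all _ fun z => by positivity)
        (hΨint r₂ hr₂.2)).2 ?_
      rw [inter_eq_right.2 fun y hy => ?_]
      · exact measure_ball_pos _ _ hr₂.1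
      · exact (Real.rpow_pos_of_pos ((sub_pos.2 hr₂.2).trans_le (hdout r₂ y hy)) _).ne'
    have h0 := hr₁.1
    change -1 * C r₁ + 2 * Φ r₁ + r₁ * (1 * C 1 + 2 * Ψ r₁) <
      -1 * C r₂ + 2 * Φ r₂ + r₂ * (1 * C 1 + 2 * Ψ r₂)
    nlinarith [mul_le_mul_of_nonneg_left hΨ h0.le, mul_lt_mul_of_pos_right hr hΨpos,
      mul_le_mul_of_nonneg_right hr.le hC1]
end

section
/- Let n ≥ 1 and s ∈ (0,1). For r ∈ (0,1) let A_r = B_1 \ B_r and x_r ∈ ∂B_r. Then the principal value H_s(x_r, A_r) exists for every r ∈ (0,1), and the map r ↦ H_s(x_r, A_r) is strictly increasing on (0,1). -/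
open MeasureTheory Filter Metric Set

section NormedSpace

variable {V : Type*} [NormedAddCommGroup V] [InnerProductSpace ℝ V]

theorem norm_smul_sub_sq {e : V} (he : ‖e‖ = 1) (t : ℝ) (z : V) :
    ‖t • e - z‖ ^ 2 = t ^ 2 - 2 * t * inner ℝ z e + ‖z‖ ^ 2 := by
  rw [norm_sub_sq_real, norm_smul, he, real_inner_smul_left, real_inner_comm]
  simp
  ring

/-- Points of the exterior of the unit ball, seen from `t • e`. -/
def unitBallExterior (e : V) (t : ℝ) : Set V := {z | 1 ≤ ‖t • e - z‖}

/-- The complement of the two balls of radius `r` touching at the origin in direction `e`. -/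
def tangentBallsExterior (e : V) (r : ℝ) : Set V := {z | 2 * r * |inner ℝ z e| ≤ ‖z‖ ^ 2}

theorem one_sub_le_norm_of_mem_unitBallExterior {e : V} (he : ‖e‖ = 1) {t : ℝ} (ht : 0 ≤ t) {z : V}
    (hz : z ∈ unitBallExterior e t) : 1 - t ≤ ‖z‖ := by
  have h1 : 1 ≤ ‖t • e - z‖ := hz
  have h2 := norm_sub_le (t • e) z
  rw [norm_smul, he, Real.norm_of_nonneg ht] at h2
  linarith

variable [MeasurableSpace V] [BorelSpace V]

theorem measurableSet_unitBallExterior (e : V) (t : ℝ) :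
    MeasurableSet (unitBallExterior e t) :=
  measurableSet_le measurable_const (by fun_prop)

theorem measurableSet_tangentBallsExterior (e : V) (r : ℝ) :
    MeasurableSet (tangentBallsExterior e r) :=
  (isClosed_le (by fun_prop) (by fun_prop)).measurableSet

variable [FiniteDimensional ℝ V]

theorem integrableOn_norm_rpow_of_le_norm {p : ℝ} (hp : (Module.finrank ℝ V : ℝ) < p)
    {δ : ℝ} (hδ : 0 < δ) {S : Set V} (hS : MeasurableSet S) (hSδ : ∀ z ∈ S, δ ≤ ‖z‖) :
    IntegrableOn (fun z : V => ‖z‖ ^ (-p)) S := by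
  have hp0 : 0 ≤ p := (Nat.cast_nonneg _).trans hp.le
  have hK_int : Integrable (fun z : V => (δ / (1 + δ)) ^ (-p) * (1 + ‖z‖) ^ (-p)) volume :=
    (integrable_one_add_norm hp).const_mul _
  refine hK_int.integrableOn.mono' (measurable_norm.pow_const _).aestronglyMeasurable ?_
  filter_upwards [ae_restrict_mem hS] with z hz
  have hz' := hSδ z hz
  have h1 : 0 < ‖z‖ := hδ.trans_le hz'
  rw [Real.norm_of_nonneg (by positivity), ← Real.mul_rpow (by positivity) (by positivity)]
  refine Real.rpow_le_rpow_of_nonpos (by positivity) ?_ (by linarith)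
  rw [div_mul_eq_mul_div, div_le_iff₀ (by positivity)]
  nlinarith

theorem tendsto_setIntegral_inter_lt_norm {p : ℝ} (hp : p ≠ 0) {S : Set V}
    (hK_int : IntegrableOn (fun z : V => ‖z‖ ^ p) S) :
    Tendsto (fun ε : ℝ => ∫ z in {z : V | ε < ‖z‖} ∩ S, ‖z‖ ^ p) (nhdsWithin 0 (Ioi 0))
      (nhds (∫ z in S, ‖z‖ ^ p)) := by
  have hR (ε : ℝ) : MeasurableSet {z : V | ε < ‖z‖} :=
    measurableSet_lt measurable_const measurable_norm
  have heq (ε : ℝ) : ∫ z in {z : V | ε < ‖z‖} ∩ S, ‖z‖ ^ p =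
      ∫ z in S, {z : V | ε < ‖z‖}.indicator (fun z => ‖z‖ ^ p) z := by
    rw [setIntegral_indicator (hR ε), inter_comm]
  simp only [heq]
  refine tendsto_integral_filter_of_dominated_convergence (fun z => ‖z‖ ^ p) ?_ ?_ hK_int ?_
  · exact .of_forall fun ε =>
      ((measurable_norm.pow_const p).indicator (hR ε)).aestronglyMeasurable
  · refine .of_forall fun ε => .of_forall fun z => ?_
    refine (norm_indicator_le_norm_self _ _).trans (Real.norm_of_nonneg (by positivity)).le
  · refine .of_forall fun z => tendsto_const_nhds.congr' ?_
    rcases eq_or_ne z 0 with rfl | hz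
    · filter_upwards [self_mem_nhdsWithin] with ε (hε : 0 < ε)
      simp [indicator_apply, Real.zero_rpow hp]
    · filter_upwards [nhdsWithin_le_nhds (Iio_mem_nhds (norm_pos_iff.2 hz))] with ε hε
      rw [indicator_of_mem (by exact hε)]

theorem integrableOn_unitBallExterior {e : V} (he : ‖e‖ = 1) {p : ℝ}
    (hp : (Module.finrank ℝ V : ℝ) < p) {t : ℝ} (ht : t ∈ Ioo (0 : ℝ) 1) :
    IntegrableOn (fun z : V => ‖z‖ ^ (-p)) (unitBallExterior e t) :=
  integrableOn_norm_rpow_of_le_norm hp (sub_pos.2 ht.2) (measurableSet_unitBallExterior e t)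
    fun _ hz => one_sub_le_norm_of_mem_unitBallExterior he ht.1.le hz

theorem setIntegral_unitBallExterior_mono {e : V} (he : ‖e‖ = 1) {p : ℝ}
    (hp : (Module.finrank ℝ V : ℝ) < p) {r t : ℝ} (hr : r ∈ Ioo (0 : ℝ) 1)
    (ht : t ∈ Ioo (0 : ℝ) 1) (hrt : r < t) :
    ∫ z in unitBallExterior e r, ‖z‖ ^ (-p) ≤ ∫ z in unitBallExterior e t, ‖z‖ ^ (-p) := by
  have hp0 : 0 ≤ p := (Nat.cast_nonneg _).trans hp.le
  set A := unitBallExterior e r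
  set B := unitBallExterior e t
  have hA : MeasurableSet A := measurableSet_unitBallExterior e r
  have hB : MeasurableSet B := measurableSet_unitBallExterior e t
  have hiA : IntegrableOn (fun z : V => ‖z‖ ^ (-p)) A := integrableOn_unitBallExterior he hp hr
  have hiB : IntegrableOn (fun z : V => ‖z‖ ^ (-p)) B := integrableOn_unitBallExterior he hp ht
  rw [← integral_inter_add_sdiff hB hiA, ← integral_inter_add_sdiff hA hiB, inter_comm B A]
  gcongr 1
  set f : V → V := fun z => (r + t) • e - z
  have hf : MeasurePreserving f volume volume := Measure.measurePreserving_sub_left volume _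
  have hfe : MeasurableEmbedding f := measurableEmbedding_subLeft _
  have hmem (z : V) : f z ∈ B \ A ↔ z ∈ A \ B := by
    have h1 : t • e - f z = -(r • e - z) := by simp only [f]; module
    have h2 : r • e - f z = -(t • e - z) := by simp only [f]; module
    change 1 ≤ ‖t • e - f z‖ ∧ ¬ 1 ≤ ‖r • e - f z‖ ↔ 1 ≤ ‖r • e - z‖ ∧ ¬ 1 ≤ ‖t • e - z‖
    rw [h1, h2, norm_neg, norm_neg]
  have hpre : f ⁻¹' (B \ A) = A \ B := by ext z; exact hmem z
  rw [← hf.setIntegral_preimage_emb hfe _ (B \ A), hpre]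
  have hi : IntegrableOn (fun z => ‖f z‖ ^ (-p)) (A \ B) := by
    rw [← hpre]
    exact (hf.integrableOn_comp_preimage hfe).2 (hiB.mono_set sdiff_subset)
  refine setIntegral_mono_on (hiA.mono_set sdiff_subset) hi (hA.diff hB) fun z hz => ?_
  have h0 : 0 < ‖f z‖ := (sub_pos.2 ht.2).trans_le
    (one_sub_le_norm_of_mem_unitBallExterior he ht.1.le ((hmem z).2 hz).1)
  refine Real.rpow_le_rpow_of_nonpos h0 ?_ (by linarith)
  have hzA : 1 ≤ ‖r • e - z‖ := hz.1
  have hzB : ‖t • e - z‖ < 1 := not_le.1 hz.2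
  have h3 : ‖t • e - z‖ ^ 2 < ‖r • e - z‖ ^ 2 := by
    gcongr
    linarith
  have h4 := norm_smul_sub_sq he (r + t) z
  rw [norm_smul_sub_sq he, norm_smul_sub_sq he] at h3
  have h5 : (t - r) * (r + t) < (t - r) * (2 * inner ℝ z e) := by linarith
  have h6 := lt_of_mul_lt_mul_left h5 (sub_pos.2 hrt).le
  refine le_of_sq_le_sq ?_ (norm_nonneg z)
  rw [h4]
  nlinarith [hr.1, ht.1]

theorem setIntegral_tangentBallsExterior_strictAnti {e : V} (he : ‖e‖ = 1) {p r t : ℝ}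
    (hr : 0 < r) (hrt : r < t)
    (hK_int : IntegrableOn (fun z : V => ‖z‖ ^ p) (tangentBallsExterior e r)) :
    ∫ z in tangentBallsExterior e t, ‖z‖ ^ p < ∫ z in tangentBallsExterior e r, ‖z‖ ^ p := by
  have hsub : tangentBallsExterior e t ⊆ tangentBallsExterior e r := fun z hz =>
    (mul_le_mul_of_nonneg_right (by linarith : 2 * r ≤ 2 * t) (abs_nonneg _)).trans hz
  rw [← sub_pos, ← setIntegral_sdiff (measurableSet_tangentBallsExterior e t) hK_int hsub,
    setIntegral_pos_iff_support_of_nonneg_ae (.of_forall fun z => by positivity)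
      (hK_int.mono_set sdiff_subset)]
  set U : Set V :=
    {z | 2 * r * |inner ℝ z e| < ‖z‖ ^ 2} ∩ {z | ‖z‖ ^ 2 < 2 * t * |inner ℝ z e|}
  have hU : IsOpen U :=
    (isOpen_lt (by fun_prop) (by fun_prop)).inter (isOpen_lt (by fun_prop) (by fun_prop))
  have hne : U.Nonempty := by
    refine ⟨(r + t) • e, ?_⟩
    have h1 : |inner ℝ ((r + t) • e) e| = r + t := by
      rw [real_inner_smul_left, real_inner_self_eq_norm_sq, he]
      simpa using (by linarith : 0 ≤ r + t)
    have h2 : ‖(r + t) • e‖ = r + t := by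
      rw [norm_smul, he, mul_one, Real.norm_of_nonneg (by linarith)]
    constructor
    · change 2 * r * |inner ℝ ((r + t) • e) e| < ‖(r + t) • e‖ ^ 2
      rw [h1, h2]
      nlinarith
    · change ‖(r + t) • e‖ ^ 2 < 2 * t * |inner ℝ ((r + t) • e) e|
      rw [h1, h2]
      nlinarith
  refine (hU.measure_pos volume hne).trans_le (measure_mono fun z hz => ?_)
  have hz1 : 2 * r * |inner ℝ z e| < ‖z‖ ^ 2 := hz.1
  have hz2 : ‖z‖ ^ 2 < 2 * t * |inner ℝ z e| := hz.2
  refine ⟨?_, hz1.le, not_le.2 hz2⟩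
  have h0 : 0 < ‖z‖ := by
    rw [norm_pos_iff]
    rintro rfl
    simp at hz1
  exact (Real.rpow_pos_of_pos h0 p).ne'

theorem setIntegral_annulus_eq {e : V} (he : ‖e‖ = 1) {p : ℝ}
    (hp : (Module.finrank ℝ V : ℝ) < p) {r : ℝ} (hr : r ∈ Ioo (0 : ℝ) 1) {ε : ℝ} (hε : 0 < ε) :
    ∫ y in {y : V | ε < dist y (r • e)},
        (indicator (ball 0 1 \ ball 0 r)ᶜ (fun _ => (1 : ℝ)) y -
          indicator (ball 0 1 \ ball 0 r) (fun _ => (1 : ℝ)) y) * ‖r • e - y‖ ^ (-p) =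
      2 * (∫ z in {z : V | ε < ‖z‖} ∩ unitBallExterior e r, ‖z‖ ^ (-p)) -
        ∫ z in {z : V | ε < ‖z‖} ∩ tangentBallsExterior e r, ‖z‖ ^ (-p) := by
  classical
  set K : V → ℝ := fun z => ‖z‖ ^ (-p) with hK
  set R : Set V := {z | ε < ‖z‖}
  set C := unitBallExterior e r
  set G := tangentBallsExterior e r
  set P : Set V := {z | ‖r • e - z‖ < r}
  set N : Set V := {z | ‖r • e + z‖ < r}
  have hR : MeasurableSet R := measurableSet_lt measurable_const measurable_norm
  have hC : MeasurableSet C := measurableSet_unitBallExterior e r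
  have hG : MeasurableSet G := measurableSet_tangentBallsExterior e r
  have hP : MeasurableSet P := measurableSet_lt (by fun_prop) measurable_const
  have hN : MeasurableSet N := measurableSet_lt (by fun_prop) measurable_const
  have hKR : IntegrableOn K R := integrableOn_norm_rpow_of_le_norm hp hε hR fun z hz => le_of_lt hz
  have memP (z : V) : z ∈ P ↔ ‖z‖ ^ 2 < 2 * r * inner ℝ z e := by
    change ‖r • e - z‖ < r ↔ _
    rw [← sq_lt_sq₀ (norm_nonneg _) hr.1.le, norm_smul_sub_sq he]
    constructor <;> intro h <;> linarith
  have memN (z : V) : z ∈ N ↔ ‖z‖ ^ 2 < 2 * r * -inner ℝ z e := by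
    have h := memP (-z)
    rw [norm_neg, inner_neg_left] at h
    rw [← h]
    change _ ↔ ‖r • e - -z‖ < r
    rw [sub_neg_eq_add]
    rfl
  have hnegPN : ∫ z in R ∩ N, K z = ∫ z in R ∩ P, K z := by
    have hpre : (fun z : V => -z) ⁻¹' (R ∩ P) = R ∩ N := by
      ext z
      change (ε < ‖-z‖ ∧ ‖r • e - -z‖ < r) ↔ (ε < ‖z‖ ∧ ‖r • e + z‖ < r)
      rw [norm_neg, sub_neg_eq_add]
    rw [← (Measure.measurePreserving_neg (volume : Measure V)).setIntegral_preimage_emb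
      (MeasurableEquiv.neg V).measurableEmbedding K (R ∩ P), hpre]
    simp [hK]
  have hsum (z : V) : K z = N.indicator K z + P.indicator K z + G.indicator K z := by
    have hGz : z ∈ G ↔ 2 * r * |inner ℝ z e| ≤ ‖z‖ ^ 2 := Iff.rfl
    have hr0 := hr.1
    simp only [indicator_apply, memP, memN, hGz]
    have h0 := sq_nonneg ‖z‖
    rcases abs_cases (inner ℝ z e : ℝ) with ⟨h, h'⟩ | ⟨h, h'⟩ <;> rw [h]
    · have h1 : ¬ ‖z‖ ^ 2 < 2 * r * -inner ℝ z e := by nlinarith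
      by_cases h2 : ‖z‖ ^ 2 < 2 * r * inner ℝ z e
      · simp only [h1, h2, not_le.2 h2, if_true, if_false, zero_add, add_zero]
      · simp only [h1, h2, not_lt.1 h2, if_true, if_false, zero_add]
    · have h1 : ¬ ‖z‖ ^ 2 < 2 * r * inner ℝ z e := by nlinarith
      by_cases h2 : ‖z‖ ^ 2 < 2 * r * -inner ℝ z e
      · simp only [h1, h2, not_le.2 h2, if_true, if_false, add_zero]
      · simp only [h1, h2, not_lt.1 h2, if_true, if_false, zero_add]
  have hpt (z : V) : ((ball (0 : V) 1 \ ball 0 r)ᶜ.indicator (fun _ => (1 : ℝ)) (r • e - z) -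
      (ball (0 : V) 1 \ ball 0 r).indicator (fun _ => (1 : ℝ)) (r • e - z)) *
        ‖r • e - (r • e - z)‖ ^ (-p) =
      2 * C.indicator K z + P.indicator K z - N.indicator K z - G.indicator K z := by
    have hCz : z ∈ C ↔ 1 ≤ ‖r • e - z‖ := Iff.rfl
    have hPz : z ∈ P ↔ ‖r • e - z‖ < r := Iff.rfl
    have hA : r • e - z ∈ ball (0 : V) 1 \ ball 0 r ↔ ¬ 1 ≤ ‖r • e - z‖ ∧ ¬ ‖r • e - z‖ < r := by
      rw [Set.mem_sdiff, mem_ball_zero_iff, mem_ball_zero_iff, not_le]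
    have h1 : 2 * C.indicator K z + P.indicator K z - N.indicator K z - G.indicator K z =
        2 * C.indicator K z + 2 * P.indicator K z - K z := by linarith [hsum z]
    rw [h1, sub_sub_cancel]
    change _ * K z = _
    simp only [indicator_apply, mem_compl_iff, hCz, hPz, hA]
    by_cases h2 : 1 ≤ ‖r • e - z‖
    · have h3 : ¬ ‖r • e - z‖ < r := by linarith [hr.2]
      simp only [h2, h3, not_true_eq_false, not_false_eq_true, false_and, if_true, if_false]
      ring
    · by_cases h3 : ‖r • e - z‖ < r <;>
        simp only [h2, h3, not_true_eq_false, not_false_eq_true, and_self, and_false, if_true,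
          if_false] <;> ring
  have hT : MeasurableSet {y : V | ε < dist y (r • e)} :=
    measurableSet_lt measurable_const (by fun_prop)
  have hi {S : Set V} (hS : MeasurableSet S) : IntegrableOn (S.indicator K) R := hKR.indicator hS
  have hpre : (fun z : V => r • e - z) ⁻¹' {y : V | ε < dist y (r • e)} = R := by
    ext z
    change ε < dist (r • e - z) (r • e) ↔ ε < ‖z‖
    rw [dist_eq_norm, sub_sub_cancel_left, norm_neg]
  rw [← (Measure.measurePreserving_sub_left (volume : Measure V) (r • e)).setIntegral_preimage_emb
    (measurableEmbedding_subLeft _), hpre]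
  simp only [hpt]
  rw [integral_sub, integral_sub, integral_add, integral_const_mul, setIntegral_indicator hC,
    setIntegral_indicator hP, setIntegral_indicator hN, setIntegral_indicator hG, hnegPN]
  · ring
  · exact (hi hC).const_mul 2
  · exact hi hP
  · exact ((hi hC).const_mul 2).add (hi hP)
  · exact hi hN
  · exact (((hi hC).const_mul 2).add (hi hP)).sub (hi hN)
  · exact hi hG

end NormedSpace

theorem measureReal_norm_le_inter_abs_apply_zero_le (m : ℕ) {ρ δ : ℝ} (hρ : 0 ≤ ρ) (hδ : 0 ≤ δ) :
    volume.real {z : EuclideanSpace ℝ (Fin (m + 1)) | ‖z‖ ≤ ρ ∧ |z 0| ≤ δ} ≤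
      2 * δ * (2 * ρ) ^ m := by
  set b : Fin (m + 1) → ℝ := Fin.cons δ fun _ => ρ
  have hb : -b ≤ b := by
    intro i
    refine Fin.cases ?_ (fun j => ?_) i <;> simp [b, hρ, hδ]
  have hmp := PiLp.volume_preserving_ofLp (Fin (m + 1))
  have hbox : volume.real (WithLp.ofLp ⁻¹' Icc (-b) b : Set (EuclideanSpace ℝ (Fin (m + 1)))) =
      2 * δ * (2 * ρ) ^ m := by
    rw [measureReal_def, hmp.measure_preimage measurableSet_Icc.nullMeasurableSet,
      Real.volume_Icc_pi_toReal hb, Fin.prod_univ_succ]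
    simp [b]
    ring
  rw [← hbox]
  refine measureReal_mono (fun z hz => ?_) ?_
  · have h (i : Fin (m + 1)) : |z i| ≤ b i := by
      refine Fin.cases hz.2 (fun j => ?_) i
      exact (PiLp.norm_apply_le z j.succ).trans hz.1
    exact ⟨fun i => (abs_le.1 (h i)).1, fun i => (abs_le.1 (h i)).2⟩
  · rw [hmp.measure_preimage measurableSet_Icc.nullMeasurableSet]
    exact measure_Icc_lt_top.ne

theorem integrableOn_tangentBallsExterior (m : ℕ) {s : ℝ} (hs : s ∈ Ioo (0 : ℝ) 1) {r : ℝ}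
    (hr : 0 < r) :
    IntegrableOn (fun z : EuclideanSpace ℝ (Fin (m + 1)) => ‖z‖ ^ (-(((m + 1 : ℕ) : ℝ) + s)))
      (tangentBallsExterior (EuclideanSpace.single 0 1) r) := by
  set p : ℝ := ((m + 1 : ℕ) : ℝ) + s with hp
  set e : EuclideanSpace ℝ (Fin (m + 1)) := EuclideanSpace.single 0 1
  set K : EuclideanSpace ℝ (Fin (m + 1)) → ℝ := fun z => ‖z‖ ^ (-p) with hK
  set G := tangentBallsExterior e r
  have hG : MeasurableSet G := measurableSet_tangentBallsExterior e r
  have hpV : (Module.finrank ℝ (EuclideanSpace ℝ (Fin (m + 1))) : ℝ) < p := by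
    rw [finrank_euclideanSpace_fin, hp]
    linarith [hs.1]
  have hp0 : 0 < p := (Nat.cast_nonneg _).trans_lt hpV
  set A : ℕ → Set (EuclideanSpace ℝ (Fin (m + 1))) := fun k =>
    {z | (1 / 2 : ℝ) ^ (k + 1) < ‖z‖} ∩ {z | ‖z‖ ≤ (1 / 2 : ℝ) ^ k} ∩ G with hAdef
  have hA (k : ℕ) : MeasurableSet (A k) :=
    ((measurableSet_lt measurable_const measurable_norm).inter
      (measurableSet_le measurable_norm measurable_const)).inter hG
  have hiA (k : ℕ) : IntegrableOn K (A k) :=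
    integrableOn_norm_rpow_of_le_norm hpV (by positivity : (0 : ℝ) < (1 / 2) ^ (k + 1)) (hA k)
      fun z hz => le_of_lt hz.1.1
  have hbound (k : ℕ) : ∫ z in A k, ‖K z‖ ≤
      2 ^ p * (2 ^ m / r) * ((1 / 2 : ℝ) ^ (1 - s)) ^ k := by
    set ρ : ℝ := (1 / 2) ^ k with hρ
    have hρ0 : 0 < ρ := by positivity
    have hsub : A k ⊆ {z | ‖z‖ ≤ ρ ∧ |z 0| ≤ ρ ^ 2 / (2 * r)} := by
      rintro z ⟨⟨-, hz⟩, hzG⟩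
      have hz : ‖z‖ ≤ ρ := hz
      have hzG : 2 * r * |inner ℝ z e| ≤ ‖z‖ ^ 2 := hzG
      refine ⟨hz, ?_⟩
      rw [le_div_iff₀ (by positivity), mul_comm]
      have : inner ℝ z e = z 0 := by simp [e, EuclideanSpace.inner_single_right]
      rw [← this]
      exact hzG.trans (by gcongr)
    have hfin : volume {z : EuclideanSpace ℝ (Fin (m + 1)) | ‖z‖ ≤ ρ ∧ |z 0| ≤ ρ ^ 2 / (2 * r)} < ⊤ :=
      (measure_mono fun z hz => mem_closedBall_zero_iff.2 hz.1).trans_lt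
        (measure_closedBall_lt_top (x := 0) (r := ρ))
    have hvol := (measureReal_mono hsub hfin.ne).trans
      (measureReal_norm_le_inter_abs_apply_zero_le m hρ0.le (by positivity))
    have hKle : ∀ z ∈ A k, ‖(‖K z‖)‖ ≤ (ρ / 2) ^ (-p) := fun z hz => by
      rw [norm_norm, Real.norm_of_nonneg (by positivity)]
      refine Real.rpow_le_rpow_of_nonpos (by positivity) ?_ (by linarith)
      have h : (1 / 2 : ℝ) ^ (k + 1) < ‖z‖ := hz.1.1
      rw [pow_succ] at h
      linarith
    have h := norm_setIntegral_le_of_norm_le_const ((measure_mono hsub).trans_lt hfin) hKle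
    refine (le_abs_self _).trans (h.trans ?_)
    refine (mul_le_mul_of_nonneg_left hvol (by positivity)).trans_eq ?_
    have h1 : (ρ / 2) ^ (-p) = 2 ^ p * ρ ^ (-p) := by
      rw [Real.div_rpow hρ0.le (by norm_num), Real.rpow_neg (by norm_num : (0 : ℝ) ≤ 2), div_inv_eq_mul,
        mul_comm]
    have h2 : ((1 / 2 : ℝ) ^ (1 - s)) ^ k = ρ ^ (-p) * ρ ^ 2 * ρ ^ m := by
      rw [← Real.rpow_natCast, ← Real.rpow_mul (by norm_num), mul_comm, Real.rpow_mul (by norm_num),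
        Real.rpow_natCast, ← hρ, ← Real.rpow_natCast ρ 2, ← Real.rpow_natCast ρ m,
        ← Real.rpow_add hρ0, ← Real.rpow_add hρ0]
      congr 1
      rw [hp]
      push_cast
      ring
    rw [h1, h2, mul_pow]
    field_simp
  have hsummable : Summable fun k => ∫ z in A k, ‖K z‖ := by
    refine .of_nonneg_of_le (fun k => by positivity) hbound ?_
    refine (summable_geometric_of_lt_one (by positivity) ?_).mul_left _
    exact Real.rpow_lt_one (by norm_num) (by norm_num) (by linarith [hs.2])
  have hnear := integrableOn_iUnion_of_summable_integral_norm hiA hsummable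
  have hfarS : MeasurableSet {z : EuclideanSpace ℝ (Fin (m + 1)) | 1 ≤ ‖z‖} :=
    measurableSet_le measurable_const measurable_norm
  have hfar : IntegrableOn K {z | 1 ≤ ‖z‖} :=
    integrableOn_norm_rpow_of_le_norm hpV one_pos hfarS fun z hz => hz
  have hzero : IntegrableOn K {0} := by simp
  refine ((hnear.union hfar).union hzero).mono_set fun z hz => ?_
  rcases eq_or_ne z 0 with rfl | h0
  · exact .inr rfl
  rcases le_or_gt 1 ‖z‖ with h1 | h1
  · exact .inl (.inr h1)
  obtain ⟨k, hk1, hk2⟩ := exists_nat_pow_near_of_lt_one (norm_pos_iff.2 h0) h1.le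
    (by norm_num : (0 : ℝ) < 1 / 2) (by norm_num)
  exact .inl (.inl (mem_iUnion.2 ⟨k, ⟨hk1, hk2⟩, hz⟩))

theorem hasFracMeanCurvAt_annulus_of_norm_eq {n : ℕ} {s ρ₁ ρ₂ H : ℝ}
    {x y : EuclideanSpace ℝ (Fin n)} (hxy : ‖x‖ = ‖y‖)
    (h : HasFracMeanCurvAt n s (ball 0 ρ₁ \ ball 0 ρ₂) y H) :
    HasFracMeanCurvAt n s (ball 0 ρ₁ \ ball 0 ρ₂) x H := by
  classical
  refine h.congr fun ε => ?_
  set L := (ℝ ∙ (x - y))ᗮ.reflection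
  have hL : L x = y := Submodule.reflection_sub hxy
  rw [← L.measurePreserving.setIntegral_preimage_emb L.toMeasurableEquiv.measurableEmbedding]
  have hpre : L ⁻¹' {z | ε < dist z y} = {z | ε < dist z x} := by
    ext z
    change ε < dist (L z) y ↔ ε < dist z x
    rw [← hL, L.dist_map]
  rw [hpre]
  congr 1 with z
  have hmem : L z ∈ ball 0 ρ₁ \ ball 0 ρ₂ ↔ z ∈ ball 0 ρ₁ \ ball 0 ρ₂ := by
    simp only [Set.mem_sdiff, mem_ball_zero_iff, L.norm_map]
  have hnorm : ‖y - L z‖ = ‖x - z‖ := by rw [← hL, ← map_sub, L.norm_map]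
  rw [hnorm]
  simp only [indicator_apply, mem_compl_iff, hmem]

theorem annulus_inner_curv_strictMono (n : ℕ) (hn : 1 ≤ n) (s : ℝ)
    (hs : s ∈ Set.Ioo (0 : ℝ) 1) :
    ∃ Hin : ℝ → ℝ,
      (∀ r ∈ Set.Ioo (0 : ℝ) 1,
        ∀ x : EuclideanSpace ℝ (Fin n), ‖x‖ = r →
          HasFracMeanCurvAt n s (Metric.ball 0 1 \ Metric.ball 0 r) x (Hin r)) ∧
      StrictMonoOn Hin (Set.Ioo (0 : ℝ) 1) := by
  obtain ⟨m, rfl⟩ := Nat.exists_eq_add_of_le' hn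
  set p : ℝ := ((m + 1 : ℕ) : ℝ) + s with hp
  set e : EuclideanSpace ℝ (Fin (m + 1)) := EuclideanSpace.single 0 1
  have he : ‖e‖ = 1 := by simp [e]
  have hpV : (Module.finrank ℝ (EuclideanSpace ℝ (Fin (m + 1))) : ℝ) < p := by
    rw [finrank_euclideanSpace_fin, hp]
    linarith [hs.1]
  have hp0 : -p ≠ 0 := neg_ne_zero.2 ((Nat.cast_nonneg _).trans_lt hpV).ne'
  refine ⟨fun r => 2 * (∫ z in unitBallExterior e r, ‖z‖ ^ (-p)) -
    ∫ z in tangentBallsExterior e r, ‖z‖ ^ (-p), fun r hr x hx => ?_, fun r hr t ht hrt => ?_⟩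
  · refine hasFracMeanCurvAt_annulus_of_norm_eq (y := r • e) ?_ ?_
    · rw [hx, norm_smul, he, mul_one, Real.norm_of_nonneg hr.1.le]
    · refine Tendsto.congr' ?_
        (((tendsto_setIntegral_inter_lt_norm hp0 (integrableOn_unitBallExterior he hpV hr)).const_mul
          2).sub (tendsto_setIntegral_inter_lt_norm hp0 (integrableOn_tangentBallsExterior m hs hr.1)))
      filter_upwards [self_mem_nhdsWithin] with ε hε
      exact (setIntegral_annulus_eq he hpV hr hε).symm
  · have h1 := setIntegral_unitBallExterior_mono he hpV hr ht hrt
    have h2 := setIntegral_tangentBallsExterior_strictAnti he hr.1 hrt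
      (integrableOn_tangentBallsExterior m hs hr.1)
    change 2 * _ - _ < 2 * _ - _
    linarith
end

section
/- Let n ≥ 1 and s ∈ (0,1). For r ∈ (0,1) let A_r = B_1 \ B_r and x_r ∈ ∂B_r. Then H_s(x_r, A_r) → −∞ as r → 0⁺, i.e. for every M there exists r₀ > 0 such that H_s(x_r, A_r) < −M for all 0 < r < r₀. -/
open MeasureTheory Filter Metric Set

/-- The sign function `χ_{Eᶜ} - χ_E`. -/
noncomputable def setSign {α : Type*} (E : Set α) (y : α) : ℝ :=
  Set.indicator Eᶜ (fun _ => (1 : ℝ)) y - Set.indicator E (fun _ => (1 : ℝ)) y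

lemma setSign_of_mem {α : Type*} {E : Set α} {y : α} (h : y ∈ E) : setSign E y = -1 := by
  simp [setSign, h]

lemma setSign_of_notMem {α : Type*} {E : Set α} {y : α} (h : y ∉ E) : setSign E y = 1 := by
  simp [setSign, h]

lemma abs_setSign {α : Type*} (E : Set α) (y : α) : |setSign E y| = 1 := by
  by_cases h : y ∈ E
  · simp [setSign_of_mem h]
  · simp [setSign_of_notMem h]

lemma measurable_setSign {α : Type*} [MeasurableSpace α] {E : Set α} (hE : MeasurableSet E) :
    Measurable (setSign E) :=
  (measurable_const.indicator hE.compl).sub (measurable_const.indicator hE)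

/-- The even part of `z ↦ setSign E (x + z)`. -/
noncomputable def symSign {V : Type*} [AddCommGroup V] (E : Set V) (x z : V) : ℝ :=
  (setSign E (x + z) + setSign E (x - z)) / 2

lemma abs_symSign_le {V : Type*} [AddCommGroup V] (E : Set V) (x z : V) :
    |symSign E x z| ≤ 1 := by
  have h₁ := abs_le.1 (abs_setSign E (x + z)).le
  have h₂ := abs_le.1 (abs_setSign E (x - z)).le
  unfold symSign
  exact abs_le.2 ⟨by linarith, by linarith⟩

lemma measurable_symSign {V : Type*} [NormedAddCommGroup V] [MeasurableSpace V] [BorelSpace V]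
    {E : Set V} (hE : MeasurableSet E) (x : V) : Measurable (symSign E x) :=
  (((measurable_setSign hE).comp (continuous_const.add continuous_id).measurable).add
    ((measurable_setSign hE).comp (continuous_const.sub continuous_id).measurable)).div_const 2

section Kernel

variable {V : Type*} [NormedAddCommGroup V] [MeasurableSpace V] [BorelSpace V]

lemma measurable_norm_rpow_s6 (q : ℝ) : Measurable (fun z : V => ‖z‖ ^ q) :=
  measurable_norm.pow_const q

lemma measurableSet_lt_norm (δ : ℝ) : MeasurableSet {z : V | δ < ‖z‖} :=
  (isOpen_lt continuous_const continuous_norm).measurableSet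

variable [NormedSpace ℝ V] [FiniteDimensional ℝ V]

lemma integrableOn_norm_rpow_neg (μ : Measure V) [μ.IsAddHaarMeasure] {p δ : ℝ}
    (hp : (Module.finrank ℝ V : ℝ) < p) (hδ : 0 < δ) :
    IntegrableOn (fun z : V => ‖z‖ ^ (-p)) {z | δ < ‖z‖} μ := by
  have hp0 : 0 < p := lt_of_le_of_lt (Nat.cast_nonneg _) hp
  have h := ((integrable_one_add_norm (μ := μ) hp).const_mul ((1 + δ⁻¹) ^ p)).integrableOn
    (s := {z | δ < ‖z‖})
  refine h.mono' (measurable_norm_rpow_s6 _).aestronglyMeasurable ?_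
  refine (ae_restrict_iff' (measurableSet_lt_norm δ)).2 (Eventually.of_forall fun z hz => ?_)
  have hz' : δ < ‖z‖ := hz
  have hz0 : 0 < ‖z‖ := hδ.trans hz'
  have hle : 1 + ‖z‖ ≤ (1 + δ⁻¹) * ‖z‖ := by
    have : 1 ≤ δ⁻¹ * ‖z‖ := by
      rw [inv_mul_eq_div, le_div_iff₀ hδ]; linarith
    nlinarith
  rw [Real.norm_of_nonneg (Real.rpow_nonneg (norm_nonneg _) _), Real.rpow_neg hz0.le,
    Real.rpow_neg (by positivity), ← div_eq_mul_inv, le_div_iff₀ (by positivity),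
    inv_mul_le_iff₀ (by positivity), mul_comm, ← Real.mul_rpow (by positivity) hz0.le]
  exact Real.rpow_le_rpow (by positivity) hle hp0.le

open scoped Pointwise in
/-- The tail integral of `‖z‖ ^ (-p)` blows up as the excised ball shrinks, for `p > dim V`. -/
lemma tendsto_setIntegral_norm_rpow_neg [Nontrivial V] (μ : Measure V) [μ.IsAddHaarMeasure]
    {p : ℝ} (hp : (Module.finrank ℝ V : ℝ) < p) :
    Tendsto (fun δ : ℝ => ∫ z in {z : V | δ < ‖z‖}, ‖z‖ ^ (-p) ∂μ)
      (nhdsWithin 0 (Set.Ioi 0)) atTop := by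
  have hpos : 0 < ∫ z in {z : V | 1 < ‖z‖}, ‖z‖ ^ (-p) ∂μ := by
    rw [setIntegral_pos_iff_support_of_nonneg_ae
      (Eventually.of_forall fun z => Real.rpow_nonneg (norm_nonneg z) _)
      (integrableOn_norm_rpow_neg μ hp one_pos)]
    have hsub : {z : V | 1 < ‖z‖} ⊆
        Function.support (fun z : V => ‖z‖ ^ (-p)) ∩ {z : V | 1 < ‖z‖} := by
      intro z hz
      exact ⟨(Real.rpow_pos_of_pos (one_pos.trans hz) _).ne', hz⟩
    refine lt_of_lt_of_le ?_ (measure_mono hsub)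
    refine (isOpen_lt continuous_const continuous_norm).measure_pos μ ?_
    obtain ⟨z, hz⟩ := NormedSpace.exists_lt_norm ℝ V 1
    exact ⟨z, hz⟩
  have hscale : ∀ δ : ℝ, 0 < δ → ∫ z in {z : V | δ < ‖z‖}, ‖z‖ ^ (-p) ∂μ =
      δ ^ ((Module.finrank ℝ V : ℝ) - p) * ∫ z in {z : V | 1 < ‖z‖}, ‖z‖ ^ (-p) ∂μ := by
    intro δ hδ
    have h := Measure.setIntegral_comp_smul_of_pos μ (fun z : V => ‖z‖ ^ (-p))
      {z : V | 1 < ‖z‖} hδ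
    have hset : δ • {z : V | 1 < ‖z‖} = {z : V | δ < ‖z‖} := by
      ext z
      rw [Set.mem_smul_set_iff_inv_smul_mem₀ hδ.ne', Set.mem_ofPred_eq, Set.mem_ofPred_eq,
        norm_smul, norm_inv, Real.norm_of_nonneg hδ.le, inv_mul_eq_div, one_lt_div hδ]
    have hfun : ∀ z : V, ‖δ • z‖ ^ (-p) = δ ^ (-p) * ‖z‖ ^ (-p) := by
      intro z
      rw [norm_smul, Real.norm_of_nonneg hδ.le, Real.mul_rpow hδ.le (norm_nonneg _)]
    simp only [hfun, hset, integral_const_mul, smul_eq_mul] at h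
    rw [sub_eq_add_neg, Real.rpow_add hδ, Real.rpow_natCast, mul_assoc, h,
      mul_inv_cancel_left₀ (by positivity)]
  have hlim := (tendsto_rpow_neg_nhdsGT_zero (sub_neg.2 hp)).atTop_mul_const hpos
  refine hlim.congr' ?_
  filter_upwards [self_mem_nhdsWithin] with δ hδ
  exact (hscale δ hδ).symm

end Kernel

/-- If the symmetrised integrand is integrable then the principal value exists and equals its
integral. -/
lemma hasFracMeanCurvAt_of_integrable {n : ℕ} (hn : 1 ≤ n) {s : ℝ} (hs : 0 < s)
    {E : Set (EuclideanSpace ℝ (Fin n))} (hE : MeasurableSet E) (x : EuclideanSpace ℝ (Fin n))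
    (hint : Integrable fun z => symSign E x z * ‖z‖ ^ (-((n : ℝ) + s))) :
    HasFracMeanCurvAt n s E x (∫ z, symSign E x z * ‖z‖ ^ (-((n : ℝ) + s))) := by
  have : Nonempty (Fin n) := ⟨⟨0, hn⟩⟩
  set p : ℝ := (n : ℝ) + s with hp
  have hpn : (Module.finrank ℝ (EuclideanSpace ℝ (Fin n)) : ℝ) < p := by
    rw [finrank_euclideanSpace_fin]; linarith
  have key : ∀ ε : ℝ, 0 < ε →
      ∫ y in {y : EuclideanSpace ℝ (Fin n) | ε < dist y x}, setSign E y * ‖x - y‖ ^ (-p) =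
      ∫ z, {z | ε < ‖z‖}.indicator (fun z => symSign E x z * ‖z‖ ^ (-p)) z := by
    intro ε hε
    have hS : MeasurableSet {y : EuclideanSpace ℝ (Fin n) | ε < dist y x} :=
      (isOpen_lt continuous_const (continuous_id.dist continuous_const)).measurableSet
    have hplus : ∫ z in {z | ε < ‖z‖}, setSign E (x + z) * ‖z‖ ^ (-p) =
        ∫ y in {y | ε < dist y x}, setSign E y * ‖x - y‖ ^ (-p) := by
      rw [← integral_indicator (measurableSet_lt_norm ε), ← integral_indicator hS,
        ← integral_add_left_eq_self ({y | ε < dist y x}.indicator _) x]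
      congr 1 with z
      simp [Set.indicator, dist_eq_norm]
    have hminus : ∫ z in {z | ε < ‖z‖}, setSign E (x - z) * ‖z‖ ^ (-p) =
        ∫ y in {y | ε < dist y x}, setSign E y * ‖x - y‖ ^ (-p) := by
      rw [← integral_indicator (measurableSet_lt_norm ε), ← integral_indicator hS,
        ← integral_sub_left_eq_self ({y | ε < dist y x}.indicator _) _ x]
      congr 1 with z
      simp [Set.indicator, dist_eq_norm]
    have hk := integrableOn_norm_rpow_neg (volume : Measure (EuclideanSpace ℝ (Fin n))) hpn hε
    have hip : IntegrableOn (fun z => setSign E (x + z) * ‖z‖ ^ (-p)) {z | ε < ‖z‖} :=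
      hk.bdd_mul (c := 1) ((measurable_setSign hE).comp
        (continuous_const.add continuous_id).measurable).aestronglyMeasurable
        (Eventually.of_forall fun z => (abs_setSign E (x + z)).le)
    have him : IntegrableOn (fun z => setSign E (x - z) * ‖z‖ ^ (-p)) {z | ε < ‖z‖} :=
      hk.bdd_mul (c := 1) ((measurable_setSign hE).comp
        (continuous_const.sub continuous_id).measurable).aestronglyMeasurable
        (Eventually.of_forall fun z => (abs_setSign E (x - z)).le)
    have hsum : ∫ z in {z | ε < ‖z‖}, symSign E x z * ‖z‖ ^ (-p) =
        (1 / 2) * (∫ z in {z | ε < ‖z‖}, setSign E (x + z) * ‖z‖ ^ (-p)) +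
        (1 / 2) * ∫ z in {z | ε < ‖z‖}, setSign E (x - z) * ‖z‖ ^ (-p) := by
      rw [← integral_const_mul, ← integral_const_mul,
        ← integral_add (hip.const_mul _) (him.const_mul _)]
      congr 1 with z
      simp only [symSign]
      ring
    rw [integral_indicator (measurableSet_lt_norm ε), hsum, hplus, hminus]
    ring
  have hlim : Tendsto
      (fun ε : ℝ => ∫ z, {z | ε < ‖z‖}.indicator (fun z => symSign E x z * ‖z‖ ^ (-p)) z)
      (nhdsWithin 0 (Set.Ioi 0)) (nhds (∫ z, symSign E x z * ‖z‖ ^ (-p))) := by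
    refine tendsto_integral_filter_of_dominated_convergence _
      (Eventually.of_forall fun ε =>
        hint.aestronglyMeasurable.indicator (measurableSet_lt_norm ε))
      (Eventually.of_forall fun ε => Eventually.of_forall fun z => norm_indicator_le_norm_self _ _)
      hint.norm ?_
    have hne : ∀ᵐ z : EuclideanSpace ℝ (Fin n), z ≠ 0 := by
      simp [ae_iff, measure_singleton]
    filter_upwards [hne] with z hz
    refine tendsto_const_nhds.congr' ?_
    have : ∀ᶠ ε : ℝ in nhdsWithin 0 (Set.Ioi 0), ε < ‖z‖ :=
      nhdsWithin_le_nhds (gt_mem_nhds (norm_pos_iff.2 hz))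
    filter_upwards [this] with ε hε
    exact (Set.indicator_of_mem (s := {z | ε < ‖z‖}) hε
      fun z => symSign E x z * ‖z‖ ^ (-((n : ℝ) + s))).symm
  unfold HasFracMeanCurvAt
  refine hlim.congr' ?_
  filter_upwards [self_mem_nhdsWithin] with ε hε
  exact (key ε hε).symm

/-- The fractional mean curvature is invariant under linear isometries preserving the set. -/
lemma HasFracMeanCurvAt.map {n : ℕ} {s H : ℝ} {E : Set (EuclideanSpace ℝ (Fin n))}
    {x : EuclideanSpace ℝ (Fin n)} (h : HasFracMeanCurvAt n s E x H)
    (L : EuclideanSpace ℝ (Fin n) ≃ₗᵢ[ℝ] EuclideanSpace ℝ (Fin n))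
    (hL : ∀ y, L y ∈ E ↔ y ∈ E) : HasFracMeanCurvAt n s E (L x) H := by
  unfold HasFracMeanCurvAt at h ⊢
  refine h.congr fun ε => ?_
  refine Eq.trans ?_ (L.measurePreserving.setIntegral_preimage_emb
    L.toHomeomorph.toMeasurableEquiv.measurableEmbedding _ _)
  have hset : L ⁻¹' {y | ε < dist y (L x)} = {y | ε < dist y x} := by
    ext y
    simp [L.dist_map]
  rw [hset]
  congr 1 with y
  rw [← map_sub, L.norm_map]
  by_cases hy : y ∈ E
  · simp [hy, (hL y).2 hy]
  · simp [hy, mt (hL y).1 hy]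

lemma ae_coord_ne_zero (n : ℕ) :
    ∀ᵐ z : EuclideanSpace ℝ (Fin n), ∀ i, z i ≠ 0 := by
  refine ae_all_iff.2 fun i => ?_
  have hae : ∀ᵐ w : Fin n → ℝ, w i ≠ 0 := by
    have := (Measure.quasiMeasurePreserving_eval (μ := fun _ : Fin n => (volume : Measure ℝ)) i).ae
      (p := fun t => t ≠ 0) (by simp [ae_iff, measure_singleton])
    exact this
  exact (PiLp.volume_preserving_ofLp (Fin n)).quasiMeasurePreserving.ae hae

/-- A product of one-dimensional power singularities, truncated to the unit cube, is integrable. -/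
lemma integrable_prod_indicator_rpow_neg (n : ℕ) {a : ℝ} (ha : a < 1) :
    Integrable fun z : EuclideanSpace ℝ (Fin n) =>
      ∏ i, (Set.Icc (-1 : ℝ) 1).indicator (fun t => |t| ^ (-a)) (z i) := by
  have h1 : Integrable ((Set.Icc (-1 : ℝ) 1).indicator fun t => |t| ^ (-a)) := by
    rw [integrable_indicator_iff measurableSet_Icc,
      ← intervalIntegrable_iff_integrableOn_Icc_of_le (by norm_num)]
    have hpos : IntervalIntegrable (fun t : ℝ => |t| ^ (-a)) volume 0 1 := by
      refine (intervalIntegral.intervalIntegrable_rpow' (a := 0) (b := 1)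
        (by linarith : -1 < -a)).congr ?_
      intro t ht
      rw [Set.uIoc_of_le zero_le_one] at ht
      simp only [abs_of_pos ht.1]
    have hneg : IntervalIntegrable (fun t : ℝ => |t| ^ (-a)) volume (-1) 0 := by
      have := ((IntervalIntegrable.iff_comp_neg (f := fun t : ℝ => |t| ^ (-a))).1 hpos).symm
      simpa using this
    exact hneg.trans hpos
  have h2 := Integrable.fintype_prod (ι := Fin n) (μ := fun _ => (volume : Measure ℝ))
    (f := fun _ => (Set.Icc (-1 : ℝ) 1).indicator fun t => |t| ^ (-a)) (fun _ => h1)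
  exact ((PiLp.volume_preserving_ofLp (Fin n)).integrable_comp_emb
    (MeasurableEquiv.toLp 2 (Fin n → ℝ)).symm.measurableEmbedding).2 h2

/-- Near the origin, the region pinched between two tangent spheres carries a kernel controlled by
a product of one-dimensional singularities. -/
lemma norm_rpow_neg_le_prod {n : ℕ} {s r : ℝ} (hs : 0 < s) (hr : 0 < r) (i₀ : Fin n)
    {z : EuclideanSpace ℝ (Fin n)} (hz : ∀ i, z i ≠ 0) (hpinch : 2 * r * |z i₀| ≤ ‖z‖ ^ 2) :
    ‖z‖ ^ (-((n : ℝ) + s)) ≤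
      (2 * r) ^ (-(((n : ℝ) + s) / (n + 1))) * ∏ i, |z i| ^ (-(((n : ℝ) + s) / (n + 1))) := by
  set a : ℝ := ((n : ℝ) + s) / (n + 1) with ha
  have ha0 : 0 < a := by positivity
  have hP : 0 < ∏ i, |z i| := Finset.prod_pos fun i _ => abs_pos.2 (hz i)
  have hle : 2 * r * ∏ i, |z i| ≤ ‖z‖ ^ (n + 1) := by
    rw [← Finset.mul_prod_erase _ _ (Finset.mem_univ i₀), ← mul_assoc]
    have hrest : ∏ i ∈ Finset.univ.erase i₀, |z i| ≤ ‖z‖ ^ (n - 1) := by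
      have := Finset.prod_le_prod (s := Finset.univ.erase i₀) (f := fun i => |z i|)
        (g := fun _ => ‖z‖) (fun i _ => abs_nonneg _) (fun i _ => PiLp.norm_apply_le z i)
      simpa [Finset.card_erase_of_mem] using this
    have hn : n + 1 = 2 + (n - 1) := by have := i₀.pos; omega
    rw [hn, pow_add]
    exact mul_le_mul hpinch hrest (Finset.prod_nonneg fun i _ => abs_nonneg _) (by positivity)
  rw [Real.finsetProd_rpow _ _ fun i _ => abs_nonneg _, ← Real.mul_rpow (by positivity) hP.le]
  have heq : ‖z‖ ^ (-((n : ℝ) + s)) = (‖z‖ ^ (n + 1)) ^ (-a) := by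
    rw [← Real.rpow_natCast, ← Real.rpow_mul (norm_nonneg _), ha]
    congr 1
    push_cast
    field_simp
  rw [heq]
  exact Real.rpow_le_rpow_of_nonpos (by positivity) hle (by linarith)

lemma symSign_annulus_eq_neg_one {V : Type*} [NormedAddCommGroup V] {x z : V}
    (hxz : ‖x‖ + ‖z‖ < 1) (hz : 2 * ‖x‖ < ‖z‖) :
    symSign (ball (0 : V) 1 \ ball 0 ‖x‖) x z = -1 := by
  have h1 : ‖x + z‖ < 1 := (norm_add_le x z).trans_lt hxz
  have h2 : ‖x - z‖ < 1 := (norm_sub_le x z).trans_lt hxz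
  have h3 : ‖x‖ ≤ ‖x + z‖ := by
    have := norm_sub_le (x + z) x
    rw [add_sub_cancel_left] at this
    linarith
  have h4 : ‖x‖ ≤ ‖x - z‖ := by
    have := norm_sub_le x (x - z)
    rw [sub_sub_cancel] at this
    linarith
  unfold symSign
  rw [setSign_of_mem (by simp [h1, h3]), setSign_of_mem (by simp [h2, h4])]
  norm_num

section Annulus

variable {V : Type*} [NormedAddCommGroup V] [InnerProductSpace ℝ V] {x z : V}

lemma symSign_annulus_eq_zero (hxz : ‖x‖ + ‖z‖ < 1)
    (hz : ‖z‖ ^ 2 < 2 * |inner ℝ x z|) :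
    symSign (ball (0 : V) 1 \ ball 0 ‖x‖) x z = 0 := by
  have hadd := norm_add_sq_real x z
  have hsub := norm_sub_sq_real x z
  have h1 : ‖x + z‖ < 1 := (norm_add_le x z).trans_lt hxz
  have h2 : ‖x - z‖ < 1 := (norm_sub_le x z).trans_lt hxz
  unfold symSign
  rcases le_total 0 (inner ℝ x z) with hi | hi
  · rw [abs_of_nonneg hi] at hz
    have h3 : ‖x‖ ≤ ‖x + z‖ := le_of_sq_le_sq (by nlinarith [sq_nonneg ‖z‖]) (norm_nonneg _)
    have h4 : ‖x - z‖ < ‖x‖ := lt_of_pow_lt_pow_left₀ 2 (norm_nonneg _) (by linarith)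
    rw [setSign_of_mem (by simp [h1, h3]), setSign_of_notMem (by simp [h4])]
    norm_num
  · rw [abs_of_nonpos hi] at hz
    have h3 : ‖x‖ ≤ ‖x - z‖ := le_of_sq_le_sq (by nlinarith [sq_nonneg ‖z‖]) (norm_nonneg _)
    have h4 : ‖x + z‖ < ‖x‖ := lt_of_pow_lt_pow_left₀ 2 (norm_nonneg _) (by linarith)
    rw [setSign_of_notMem (by simp [h4]), setSign_of_mem (by simp [h2, h3])]
    norm_num

lemma symSign_annulus_nonpos (hxz : ‖x‖ + ‖z‖ < 1) :
    symSign (ball (0 : V) 1 \ ball 0 ‖x‖) x z ≤ 0 := by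
  have hadd := norm_add_sq_real x z
  have hsub := norm_sub_sq_real x z
  have h1 : ‖x + z‖ < 1 := (norm_add_le x z).trans_lt hxz
  have h2 : ‖x - z‖ < 1 := (norm_sub_le x z).trans_lt hxz
  have hb₁ := (abs_le.1 (abs_setSign (ball (0 : V) 1 \ ball 0 ‖x‖) (x + z)).le).2
  have hb₂ := (abs_le.1 (abs_setSign (ball (0 : V) 1 \ ball 0 ‖x‖) (x - z)).le).2
  unfold symSign
  rcases le_total 0 (inner ℝ x z) with hi | hi
  · have h3 : ‖x‖ ≤ ‖x + z‖ := le_of_sq_le_sq (by nlinarith [sq_nonneg ‖z‖]) (norm_nonneg _)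
    rw [setSign_of_mem (y := x + z) (by simp [h1, h3])]
    linarith
  · have h3 : ‖x‖ ≤ ‖x - z‖ := le_of_sq_le_sq (by nlinarith [sq_nonneg ‖z‖]) (norm_nonneg _)
    rw [setSign_of_mem (y := x - z) (by simp [h2, h3])]
    linarith

end Annulus

lemma integrable_symSign_annulus {n : ℕ} {s r : ℝ} (hs : s ∈ Set.Ioo (0 : ℝ) 1)
    (hr : r ∈ Set.Ioo (0 : ℝ) 1) (i₀ : Fin n) :
    Integrable fun z : EuclideanSpace ℝ (Fin n) =>
      symSign (ball 0 1 \ ball 0 r) (EuclideanSpace.single i₀ r) z * ‖z‖ ^ (-((n : ℝ) + s)) := by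
  obtain ⟨hr0, hr1⟩ := hr
  set x : EuclideanSpace ℝ (Fin n) := EuclideanSpace.single i₀ r with hx
  have hxr : ‖x‖ = r := by simp [hx, abs_of_pos hr0]
  set p : ℝ := (n : ℝ) + s with hp
  set a : ℝ := p / (n + 1) with ha
  have ha1 : a < 1 := by
    rw [ha, div_lt_one (by positivity)]; linarith [hs.2]
  have hpn : (Module.finrank ℝ (EuclideanSpace ℝ (Fin n)) : ℝ) < p := by
    rw [finrank_euclideanSpace_fin]; linarith [hs.1]
  set δ : ℝ := (1 - r) / 2 with hδ
  have hδ0 : 0 < δ := by rw [hδ]; linarith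
  have hfar := (integrableOn_norm_rpow_neg
    (volume : Measure (EuclideanSpace ℝ (Fin n))) hpn hδ0).integrable_indicator
      (measurableSet_lt_norm δ)
  have hnear := (integrable_prod_indicator_rpow_neg n ha1).const_mul ((2 * r) ^ (-a))
  refine (hnear.add hfar).mono' ((measurable_symSign
    (measurableSet_ball.diff measurableSet_ball) x).mul
    (measurable_norm_rpow_s6 _)).aestronglyMeasurable ?_
  filter_upwards [ae_coord_ne_zero n] with z hz
  have hk : 0 ≤ ‖z‖ ^ (-p) := Real.rpow_nonneg (norm_nonneg _) _
  have hprod : 0 ≤ (2 * r) ^ (-a) *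
      ∏ i, (Set.Icc (-1 : ℝ) 1).indicator (fun t => |t| ^ (-a)) (z i) :=
    mul_nonneg (by positivity) (Finset.prod_nonneg fun i _ =>
      Set.indicator_nonneg (fun t _ => Real.rpow_nonneg (abs_nonneg _) _) _)
  have hle : ‖symSign (ball 0 1 \ ball 0 r) x z * ‖z‖ ^ (-p)‖ ≤ ‖z‖ ^ (-p) := by
    rw [norm_mul, Real.norm_eq_abs, Real.norm_of_nonneg hk]
    exact mul_le_of_le_one_left hk (abs_symSign_le _ _ _)
  simp only [Pi.add_apply]
  by_cases hzδ : δ < ‖z‖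
  · rw [Set.indicator_of_mem (show z ∈ {z | δ < ‖z‖} from hzδ)]
    linarith
  rw [Set.indicator_of_notMem (show z ∉ {z | δ < ‖z‖} from hzδ), add_zero]
  push Not at hzδ
  have hsmall : ‖x‖ + ‖z‖ < 1 := by rw [hxr]; linarith
  by_cases hpinch : ‖z‖ ^ 2 < 2 * r * |z i₀|
  · have h0 := symSign_annulus_eq_zero hsmall (by
      rw [hx, EuclideanSpace.inner_single_left]
      simpa [abs_mul, abs_of_pos hr0, mul_assoc] using hpinch)
    rw [hxr] at h0
    rw [h0, zero_mul, norm_zero]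
    exact hprod
  · have hb := norm_rpow_neg_le_prod hs.1 hr0 i₀ hz (not_lt.1 hpinch)
    have hcube : ∀ i, (Set.Icc (-1 : ℝ) 1).indicator (fun t => |t| ^ (-a)) (z i) =
        |z i| ^ (-a) := by
      intro i
      refine Set.indicator_of_mem (Set.mem_Icc.2 (abs_le.1 ?_)) _
      have : |z i| ≤ ‖z‖ := PiLp.norm_apply_le z i
      linarith
    simp only [hcube]
    exact hle.trans hb

lemma integral_symSign_annulus_le {n : ℕ} {s r : ℝ} (hs : s ∈ Set.Ioo (0 : ℝ) 1)
    (hr : r ∈ Set.Ioo (0 : ℝ) 1) (hr4 : r ≤ 1 / 4) (i₀ : Fin n) :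
    ∫ z : EuclideanSpace ℝ (Fin n),
      symSign (ball 0 1 \ ball 0 r) (EuclideanSpace.single i₀ r) z * ‖z‖ ^ (-((n : ℝ) + s)) ≤
    2 * (∫ z in {z : EuclideanSpace ℝ (Fin n) | 1 / 2 < ‖z‖}, ‖z‖ ^ (-((n : ℝ) + s))) -
      ∫ z in {z : EuclideanSpace ℝ (Fin n) | 2 * r < ‖z‖}, ‖z‖ ^ (-((n : ℝ) + s)) := by
  have hint := integrable_symSign_annulus hs hr i₀
  obtain ⟨hr0, hr1⟩ := hr
  set x : EuclideanSpace ℝ (Fin n) := EuclideanSpace.single i₀ r with hx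
  have hxr : ‖x‖ = r := by simp [hx, abs_of_pos hr0]
  have hpn : (Module.finrank ℝ (EuclideanSpace ℝ (Fin n)) : ℝ) < (n : ℝ) + s := by
    rw [finrank_euclideanSpace_fin]; linarith [hs.1]
  have hi : ∀ δ : ℝ, 0 < δ → Integrable ({z : EuclideanSpace ℝ (Fin n) | δ < ‖z‖}.indicator
      fun z => ‖z‖ ^ (-((n : ℝ) + s))) := fun δ hδ =>
    (integrableOn_norm_rpow_neg volume hpn hδ).integrable_indicator (measurableSet_lt_norm δ)
  rw [← integral_indicator (measurableSet_lt_norm _), ← integral_indicator (measurableSet_lt_norm _),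
    ← integral_const_mul, ← integral_sub ((hi _ (by norm_num)).const_mul 2) (hi _ (by linarith))]
  refine integral_mono hint (((hi _ (by norm_num)).const_mul 2).sub (hi _ (by linarith)))
    fun z => ?_
  have hk : 0 ≤ ‖z‖ ^ (-((n : ℝ) + s)) := Real.rpow_nonneg (norm_nonneg _) _
  simp only [Set.indicator, Set.mem_ofPred_eq]
  by_cases hz : 1 / 2 < ‖z‖
  · rw [if_pos hz, if_pos (by linarith)]
    have := mul_le_mul_of_nonneg_right (abs_le.1 (abs_symSign_le (ball 0 1 \ ball 0 r) x z)).2 hk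
    linarith
  have hsmall : ‖x‖ + ‖z‖ < 1 := by rw [hxr]; linarith
  rw [if_neg hz]
  by_cases hz2 : 2 * r < ‖z‖
  · have h := symSign_annulus_eq_neg_one hsmall (by rwa [hxr])
    rw [hxr] at h
    rw [if_pos hz2, h]
    linarith
  · have h := symSign_annulus_nonpos hsmall
    rw [hxr] at h
    rw [if_neg hz2]
    linarith [mul_nonpos_of_nonpos_of_nonneg h hk]

theorem annulus_inner_curv_tendsto_neg_infty (n : ℕ) (hn : 1 ≤ n) (s : ℝ)
    (hs : s ∈ Set.Ioo (0 : ℝ) 1) :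
    ∃ Hin : ℝ → ℝ,
      (∀ r ∈ Set.Ioo (0 : ℝ) 1,
        ∀ x : EuclideanSpace ℝ (Fin n), ‖x‖ = r →
          HasFracMeanCurvAt n s (Metric.ball 0 1 \ Metric.ball 0 r) x (Hin r)) ∧
      ∀ M : ℝ, ∃ r₀ > (0 : ℝ), ∀ r ∈ Set.Ioo (0 : ℝ) 1, r < r₀ → Hin r < -M := by
  let i₀ : Fin n := ⟨0, hn⟩
  have : Nonempty (Fin n) := ⟨i₀⟩
  refine ⟨fun r => ∫ z : EuclideanSpace ℝ (Fin n),
    symSign (ball 0 1 \ ball 0 r) (EuclideanSpace.single i₀ r) z * ‖z‖ ^ (-((n : ℝ) + s)),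
    fun r hr x hx => ?_, fun M => ?_⟩
  · have h := hasFracMeanCurvAt_of_integrable hn hs.1 (measurableSet_ball.diff measurableSet_ball) _
      (integrable_symSign_annulus hs hr i₀)
    have hnorm : ‖(EuclideanSpace.single i₀ r : EuclideanSpace ℝ (Fin n))‖ = ‖x‖ := by
      simp [hx, abs_of_pos hr.1]
    have hmap := h.map (ℝ ∙ (EuclideanSpace.single i₀ r - x))ᗮ.reflection (by simp)
    rwa [Submodule.reflection_sub hnorm] at hmap
  · have hpn : (Module.finrank ℝ (EuclideanSpace ℝ (Fin n)) : ℝ) < (n : ℝ) + s := by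
      rw [finrank_euclideanSpace_fin]; linarith [hs.1]
    set C := ∫ z in {z : EuclideanSpace ℝ (Fin n) | 1 / 2 < ‖z‖}, ‖z‖ ^ (-((n : ℝ) + s))
    have hev := (tendsto_setIntegral_norm_rpow_neg
      (volume : Measure (EuclideanSpace ℝ (Fin n))) hpn).eventually_gt_atTop (2 * C + M)
    obtain ⟨u, hu, hsub⟩ := mem_nhdsGT_iff_exists_Ioo_subset.1 hev
    have hu0 : 0 < u := hu
    refine ⟨min (u / 2) (1 / 4), by positivity, fun r hr hlt => ?_⟩
    have h1 := hlt.trans_le (min_le_left _ _)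
    have h2 := hlt.trans_le (min_le_right _ _)
    have hbig : 2 * C + M < ∫ z in {z : EuclideanSpace ℝ (Fin n) | 2 * r < ‖z‖},
        ‖z‖ ^ (-((n : ℝ) + s)) :=
      hsub ⟨by linarith [hr.1], by linarith⟩
    have := integral_symSign_annulus_le hs hr h2.le i₀
    simp only
    linarith
end
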